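/- arXiv:2108.02608 — 2 statements merged into one kernel-verified Lean document; each statement's English description precedes it below -/
import Mathlib

section
/- Let B be the quotient of the free associative algebra k⟨x1,y,x2,u⟩ by the two-sided ideal generated by: x1², y², x1·y + y·x1; x1·x2 − q·x2·x1; x2²; x2·z + q⁻¹·z·x2; x1·u − q·(u + x2)·x1 − z; z·u + q·u·z − w; t·u − q·(u − x2)·t; y·t + q²·(t + 2·w)·y + q·z·T; w·u − q·(u − x2)·w; T·z − z·T + (1/2)·z²; u·s − s·u − x2·s. Then the images in B of the monomials x2^{m1}·s^{m2}·u^{m3}·w^{m4}·t^{m5}·z^{m6}·T^{m7}·y^{m8}·x1^{m9}, where m1,m4,m5,m8,m9 ∈ {0,1} and m2,m3,m6,m7 ∈ ℕ, form a k-vector space basis of B. -/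
/- Statement 17: PBW basis of the Nichols algebra 𝔅(𝔖_{1,−}(q)) (Theorem 6.5 of the paper). -/

noncomputable section
namespace Stmt17

variable (k : Type*) [Field k] (q : k)

def x1 : FreeAlgebra k (Fin 4) := FreeAlgebra.ι k 0
/-- `y` stands for the generator x_{3/2} of the paper. -/
def y : FreeAlgebra k (Fin 4) := FreeAlgebra.ι k 1
def x2 : FreeAlgebra k (Fin 4) := FreeAlgebra.ι k 2
/-- `u` stands for the generator x_{5/2} of the paper. -/
def u : FreeAlgebra k (Fin 4) := FreeAlgebra.ι k 3

/-- z := y·x2 − q·x2·y (the element x_{3/2 2}) -/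
def z : FreeAlgebra k (Fin 4) := y k * x2 k - q • (x2 k * y k)
/-- T := y·u − q·(u + x2)·y (the element x_{3/2 5/2}) -/
def T : FreeAlgebra k (Fin 4) := y k * u k - q • ((u k + x2 k) * y k)
/-- s := u·x2 + x2·u (the element x_{5/2 2}) -/
def s : FreeAlgebra k (Fin 4) := u k * x2 k + x2 k * u k
/-- t := T·u + q·u·T -/
def t : FreeAlgebra k (Fin 4) := T k q * u k + q • (u k * T k q)
/-- w := T·x2 + q·x2·T -/
def w : FreeAlgebra k (Fin 4) := T k q * x2 k + q • (x2 k * T k q)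

def rels : Set (FreeAlgebra k (Fin 4)) :=
  { x1 k ^ 2, y k ^ 2, x1 k * y k + y k * x1 k,
    x1 k * x2 k - q • (x2 k * x1 k),
    x2 k ^ 2,
    x2 k * z k q + q⁻¹ • (z k q * x2 k),
    x1 k * u k - q • ((u k + x2 k) * x1 k) - z k q,
    z k q * u k + q • (u k * z k q) - w k q,
    t k q * u k - q • ((u k - x2 k) * t k q),
    y k * t k q + (q ^ 2) • ((t k q + (2 : k) • w k q) * y k) + q • (z k q * T k q),
    w k q * u k - q • ((u k - x2 k) * w k q),
    T k q * z k q - z k q * T k q + (2 : k)⁻¹ • z k q ^ 2,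
    u k * s k - s k * u k - x2 k * s k }

def rel (a b : FreeAlgebra k (Fin 4)) : Prop := a ∈ rels k q ∧ b = 0

/-- The index set of the PBW monomials. -/
structure Idx where
  m1 : Fin 2
  m2 : ℕ
  m3 : ℕ
  m4 : Fin 2
  m5 : Fin 2
  m6 : ℕ
  m7 : ℕ
  m8 : Fin 2
  m9 : Fin 2

/-- The PBW monomials x2^{m1}·s^{m2}·u^{m3}·w^{m4}·t^{m5}·z^{m6}·T^{m7}·y^{m8}·x1^{m9}. -/
def mon (i : Idx) : RingQuot (rel k q) :=
  RingQuot.mkAlgHom k (rel k q)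
    (x2 k ^ (i.m1 : ℕ) * s k ^ i.m2 * u k ^ i.m3 * w k q ^ (i.m4 : ℕ) *
      t k q ^ (i.m5 : ℕ) * z k q ^ i.m6 * T k q ^ i.m7 *
      y k ^ (i.m8 : ℕ) * x1 k ^ (i.m9 : ℕ))

set_option linter.unusedSimpArgs false

section Layers

variable {k}
variable {V : Type*} [AddCommGroup V] [Module k V]

/-- Operators on a vector space satisfying the relations of the super Jordan plane. -/
structure SuperJordan (x2 u : V →ₗ[k] V) : Prop where
  x2_x2 v : x2 (x2 v) = 0
  u_u_x2 v : u (u (x2 v)) = x2 (u (u v)) + x2 (u (x2 v))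

namespace SuperJordan

variable (k) in
/-- Multiplication by `s` on polynomials in `s` and `u`. -/
def shiftS : (ℕ × ℕ →₀ k) →ₗ[k] (ℕ × ℕ →₀ k) :=
  Finsupp.lsum k fun i => Finsupp.lsingle (i.1 + 1, i.2)

variable (k) in
/-- Multiplication by `u` on polynomials in `s` and `u`. -/
def shiftU : (ℕ × ℕ →₀ k) →ₗ[k] (ℕ × ℕ →₀ k) :=
  Finsupp.lsum k fun i => Finsupp.lsingle (i.1, i.2 + 1)

variable (k) in
/-- The Euler operator in the variable `s`. -/
def euler : (ℕ × ℕ →₀ k) →ₗ[k] (ℕ × ℕ →₀ k) :=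
  Finsupp.lsum k fun i => (i.1 : k) • Finsupp.lsingle i

variable (k) in
/-- Left multiplication by `x2` on `k[s, u] ⊕ x2 k[s, u]`. -/
def opX2 : (ℕ × ℕ →₀ k) × (ℕ × ℕ →₀ k) →ₗ[k] (ℕ × ℕ →₀ k) × (ℕ × ℕ →₀ k) :=
  LinearMap.prod 0 (LinearMap.fst ..)

variable (k) in
/-- Left multiplication by `u` on `k[s, u] ⊕ x2 k[s, u]`. -/
def opU : (ℕ × ℕ →₀ k) × (ℕ × ℕ →₀ k) →ₗ[k] (ℕ × ℕ →₀ k) × (ℕ × ℕ →₀ k) :=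
  LinearMap.prod (LinearMap.coprod (shiftU k) (shiftS k)) (LinearMap.coprod (euler k) (-shiftU k))

@[simp]
lemma shiftS_single (i : ℕ × ℕ) (c : k) :
    shiftS k (Finsupp.single i c) = Finsupp.single (i.1 + 1, i.2) c := by
  simp [shiftS]

@[simp]
lemma shiftU_single (i : ℕ × ℕ) (c : k) :
    shiftU k (Finsupp.single i c) = Finsupp.single (i.1, i.2 + 1) c := by
  simp [shiftU]

@[simp]
lemma euler_single (i : ℕ × ℕ) (c : k) :
    euler k (Finsupp.single i c) = Finsupp.single i (i.1 * c) := by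
  rw [euler, Finsupp.lsum_single]
  simp

lemma euler_shiftS (a : ℕ × ℕ →₀ k) : euler k (shiftS k a) = shiftS k (euler k a) + shiftS k a := by
  induction a using Finsupp.induction_linear with
  | zero => simp
  | add f g hf hg => simp only [map_add, hf, hg]; abel
  | single i c => simp [-Finsupp.single_mul, ← Finsupp.single_add, add_mul]

lemma shift_comm (a : ℕ × ℕ →₀ k) : shiftU k (shiftS k a) = shiftS k (shiftU k a) := by
  induction a using Finsupp.induction_linear with
  | zero => simp
  | add f g hf hg => simp only [map_add, hf, hg]
  | single i c => simp

lemma euler_shiftU (a : ℕ × ℕ →₀ k) : euler k (shiftU k a) = shiftU k (euler k a) := by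
  induction a using Finsupp.induction_linear with
  | zero => simp
  | add f g hf hg => simp only [map_add, hf, hg]
  | single i c => simp [-Finsupp.single_mul]

lemma regular : SuperJordan (opX2 k) (opU k) where
  x2_x2 v := by simp [opX2]
  u_u_x2 v := by
    ext1 <;> simp [opX2, opU, euler_shiftS, euler_shiftU, shift_comm] <;> abel

end SuperJordan

/-- Operators satisfying the relations of the super Jordan plane extended by `w` and `t`. -/
structure ExtJordan (q : k) (x2 u w t : V →ₗ[k] V) : Prop extends SuperJordan x2 u where
  w_x2 v : w (x2 v) = q • x2 (w v)
  w_u v : w (u v) = q • (u (w v) - x2 (w v))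
  t_x2 v : t (x2 v) = q • x2 (t v)
  t_u v : t (u v) = q • (u (t v) - x2 (t v))
  w_w v : w (w v) = 0
  t_t v : t (t v) = 0
  t_w v : t (w v) = -w (t v)

namespace ExtJordan

/-- Left multiplication by `w` on `(V ⊕ tV) ⊕ w(V ⊕ tV)`. -/
def opW : (V × V) × (V × V) →ₗ[k] (V × V) × (V × V) where
  toFun a := ((0, 0), a.1)
  map_add' a b := by ext <;> simp
  map_smul' c a := by ext <;> simp

/-- Left multiplication by `t` on `(V ⊕ tV) ⊕ w(V ⊕ tV)`. -/
def opT : (V × V) × (V × V) →ₗ[k] (V × V) × (V × V) where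
  toFun a := ((0, a.1.1), (0, -a.2.1))
  map_add' a b := by ext <;> simp <;> module
  map_smul' c a := by ext <;> simp

/-- Left multiplication by `x2` on `(V ⊕ tV) ⊕ w(V ⊕ tV)`. -/
def opX2 (q : k) (x2 : V →ₗ[k] V) : (V × V) × (V × V) →ₗ[k] (V × V) × (V × V) where
  toFun a := ((x2 a.1.1, q⁻¹ • x2 a.1.2), (q⁻¹ • x2 a.2.1, (q⁻¹ * q⁻¹) • x2 a.2.2))
  map_add' a b := by ext <;> simp
  map_smul' c a := by ext <;> simp <;> module

/-- Left multiplication by `u` on `(V ⊕ tV) ⊕ w(V ⊕ tV)`. -/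
def opU (q : k) (x2 u : V →ₗ[k] V) : (V × V) × (V × V) →ₗ[k] (V × V) × (V × V) where
  toFun a := ((u a.1.1, q⁻¹ • (u a.1.2 + x2 a.1.2)),
    (q⁻¹ • (u a.2.1 + x2 a.2.1), (q⁻¹ * q⁻¹) • (u a.2.2 + (2 : k) • x2 a.2.2)))
  map_add' a b := by ext <;> simp <;> module
  map_smul' c a := by ext <;> simp <;> module

variable {q : k} {x2 u : V →ₗ[k] V}

lemma extend (hq : q ≠ 0) (h : SuperJordan x2 u) :
    ExtJordan q (opX2 q x2) (opU q x2 u) opW opT := by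
  constructor
  · constructor <;> intro v <;> ext <;> simp [opX2, opU, h.x2_x2, h.u_u_x2] <;> module
  all_goals
    intro v
    ext <;> simp [opX2, opU, opW, opT, smul_smul] <;> match_scalars <;> field_simp <;> ring

end ExtJordan

/-- Operators satisfying the commutation relations between `x2`, `u`, `w`, `t`, `z` and `T`. -/
structure JordanTower (q : k) (x2 u w t z T : V →ₗ[k] V) : Prop
    extends ExtJordan q x2 u w t where
  z_x2 v : z (x2 v) = -(q • x2 (z v))
  z_u v : z (u v) = w v - q • u (z v)
  z_w v : z (w v) = -(q • w (z v))
  z_t v : z (t v) = -(q • (t (z v) + w (z v)))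
  T_x2 v : T (x2 v) = w v - q • x2 (T v)
  T_u v : T (u v) = t v - q • u (T v)
  T_w v : T (w v) = -(q • w (T v))
  T_t v : T (t v) = -(q • (t (T v) + w (T v)))
  T_z v : T (z v) = z (T v) - (2 : k)⁻¹ • z (z v)

namespace JordanTower

section Weyl

variable (k V)

/-- Multiplication by the first variable on `V`-valued polynomials in two variables. -/
def mulZ : (ℕ × ℕ →₀ V) →ₗ[k] (ℕ × ℕ →₀ V) :=
  Finsupp.lsum k fun i => Finsupp.lsingle (i.1 + 1, i.2)

/-- Multiplication by the second variable on `V`-valued polynomials in two variables. -/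
def mulT : (ℕ × ℕ →₀ V) →ₗ[k] (ℕ × ℕ →₀ V) :=
  Finsupp.lsum k fun i => Finsupp.lsingle (i.1, i.2 + 1)

/-- The partial derivative in the first variable. -/
def derivZ : (ℕ × ℕ →₀ V) →ₗ[k] (ℕ × ℕ →₀ V) :=
  Finsupp.lsum k fun i => (i.1 : k) • Finsupp.lsingle (i.1 - 1, i.2)

/-- The partial derivative in the second variable. -/
def derivT : (ℕ × ℕ →₀ V) →ₗ[k] (ℕ × ℕ →₀ V) :=
  Finsupp.lsum k fun i => (i.2 : k) • Finsupp.lsingle (i.1, i.2 - 1)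

variable {k} in
/-- Rescaling of both variables by `r`. -/
def scale (r : k) : (ℕ × ℕ →₀ V) →ₗ[k] (ℕ × ℕ →₀ V) :=
  Finsupp.lsum k fun i => r ^ (i.1 + i.2) • Finsupp.lsingle i

variable {V}

@[simp]
lemma mulZ_single (i : ℕ × ℕ) (v : V) :
    mulZ k V (Finsupp.single i v) = Finsupp.single (i.1 + 1, i.2) v := by
  simp [mulZ]

@[simp]
lemma mulT_single (i : ℕ × ℕ) (v : V) :
    mulT k V (Finsupp.single i v) = Finsupp.single (i.1, i.2 + 1) v := by
  simp [mulT]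

@[simp]
lemma derivZ_single (i : ℕ × ℕ) (v : V) :
    derivZ k V (Finsupp.single i v) = Finsupp.single (i.1 - 1, i.2) ((i.1 : k) • v) := by
  rw [derivZ, Finsupp.lsum_single]
  simp

@[simp]
lemma derivT_single (i : ℕ × ℕ) (v : V) :
    derivT k V (Finsupp.single i v) = Finsupp.single (i.1, i.2 - 1) ((i.2 : k) • v) := by
  rw [derivT, Finsupp.lsum_single]
  simp

variable {k}

@[simp]
lemma scale_single (r : k) (i : ℕ × ℕ) (v : V) :
    scale V r (Finsupp.single i v) = Finsupp.single i (r ^ (i.1 + i.2) • v) := by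
  rw [scale, Finsupp.lsum_single]
  simp

/-- The coefficientwise action of a linear map. -/
abbrev coeffwise (f : V →ₗ[k] V) : (ℕ × ℕ →₀ V) →ₗ[k] (ℕ × ℕ →₀ V) :=
  Finsupp.mapRange.linearMap f

lemma commute_of_single {f g : (ℕ × ℕ →₀ V) →ₗ[k] (ℕ × ℕ →₀ V)}
    (h : ∀ i v, f (Finsupp.single i v) = g (Finsupp.single i v)) (p : ℕ × ℕ →₀ V) :
    f p = g p := by
  congr 1
  ext1 i
  ext1 v
  exact h i v

variable (p : ℕ × ℕ →₀ V)

lemma mulT_mulZ : mulT k V (mulZ k V p) = mulZ k V (mulT k V p) :=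
  commute_of_single (f := mulT k V ∘ₗ mulZ k V) (g := mulZ k V ∘ₗ mulT k V) (by simp) p

lemma derivZ_mulZ : derivZ k V (mulZ k V p) = mulZ k V (derivZ k V p) + p :=
  commute_of_single (f := derivZ k V ∘ₗ mulZ k V)
    (g := mulZ k V ∘ₗ derivZ k V + LinearMap.id) (by
      rintro ⟨a | a, b⟩ v <;> simp [add_smul]) p

lemma derivT_mulT : derivT k V (mulT k V p) = mulT k V (derivT k V p) + p :=
  commute_of_single (f := derivT k V ∘ₗ mulT k V)
    (g := mulT k V ∘ₗ derivT k V + LinearMap.id) (by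
      rintro ⟨a, b | b⟩ v <;> simp [add_smul]) p

lemma derivZ_mulT : derivZ k V (mulT k V p) = mulT k V (derivZ k V p) :=
  commute_of_single (f := derivZ k V ∘ₗ mulT k V) (g := mulT k V ∘ₗ derivZ k V) (by simp) p

lemma derivT_mulZ : derivT k V (mulZ k V p) = mulZ k V (derivT k V p) :=
  commute_of_single (f := derivT k V ∘ₗ mulZ k V) (g := mulZ k V ∘ₗ derivT k V) (by simp) p

lemma derivT_derivZ : derivT k V (derivZ k V p) = derivZ k V (derivT k V p) :=
  commute_of_single (f := derivT k V ∘ₗ derivZ k V) (g := derivZ k V ∘ₗ derivT k V)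
    (by intro i v; simp; rw [smul_comm]) p

lemma scale_mulZ (r : k) : scale V r (mulZ k V p) = r • mulZ k V (scale V r p) :=
  commute_of_single (f := scale V r ∘ₗ mulZ k V) (g := r • mulZ k V ∘ₗ scale V r)
    (by intro i v; simp; congr 1; module) p

lemma scale_mulT (r : k) : scale V r (mulT k V p) = r • mulT k V (scale V r p) :=
  commute_of_single (f := scale V r ∘ₗ mulT k V) (g := r • mulT k V ∘ₗ scale V r)
    (by intro i v; simp; congr 1; module) p

lemma scale_derivZ {r : k} (hr : r ≠ 0) :
    scale V r (derivZ k V p) = r⁻¹ • derivZ k V (scale V r p) :=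
  commute_of_single (f := scale V r ∘ₗ derivZ k V) (g := r⁻¹ • derivZ k V ∘ₗ scale V r)
    (by
      rintro ⟨a | a, b⟩ v
      · simp
      · simp; congr 1; match_scalars; field_simp; ring) p

lemma scale_derivT {r : k} (hr : r ≠ 0) :
    scale V r (derivT k V p) = r⁻¹ • derivT k V (scale V r p) :=
  commute_of_single (f := scale V r ∘ₗ derivT k V) (g := r⁻¹ • derivT k V ∘ₗ scale V r)
    (by
      rintro ⟨a, b | b⟩ v
      · simp
      · simp; congr 1; match_scalars; field_simp; ring) p

variable (f : V →ₗ[k] V)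

lemma coeffwise_mulZ : coeffwise f (mulZ k V p) = mulZ k V (coeffwise f p) :=
  commute_of_single (f := coeffwise f ∘ₗ mulZ k V) (g := mulZ k V ∘ₗ coeffwise f) (by simp) p

lemma coeffwise_mulT : coeffwise f (mulT k V p) = mulT k V (coeffwise f p) :=
  commute_of_single (f := coeffwise f ∘ₗ mulT k V) (g := mulT k V ∘ₗ coeffwise f) (by simp) p

lemma coeffwise_derivZ : coeffwise f (derivZ k V p) = derivZ k V (coeffwise f p) :=
  commute_of_single (f := coeffwise f ∘ₗ derivZ k V) (g := derivZ k V ∘ₗ coeffwise f)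
    (by simp) p

lemma coeffwise_derivT : coeffwise f (derivT k V p) = derivT k V (coeffwise f p) :=
  commute_of_single (f := coeffwise f ∘ₗ derivT k V) (g := derivT k V ∘ₗ coeffwise f)
    (by simp) p

lemma coeffwise_scale (r : k) : coeffwise f (scale V r p) = scale V r (coeffwise f p) :=
  commute_of_single (f := coeffwise f ∘ₗ scale V r) (g := scale V r ∘ₗ coeffwise f)
    (by simp) p

end Weyl

variable {q : k} {x2 u w t : V →ₗ[k] V}

lemma _root_.Stmt17.ExtJordan.coeffwise (h : ExtJordan q x2 u w t) :
    ExtJordan q (coeffwise x2) (coeffwise u) (coeffwise w) (coeffwise t) := by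
  constructor
  · constructor <;> intro v <;> ext i <;> simp [h.x2_x2, h.u_u_x2]
  all_goals
    intro v
    ext i
    simp [h.w_x2, h.w_u, h.t_x2, h.t_u, h.w_w, h.t_t, h.t_w]

/-- Left multiplication by `x2` on `V`-valued polynomials in `z` and `T`. -/
def opX2 (q : k) (x2 w : V →ₗ[k] V) : (ℕ × ℕ →₀ V) →ₗ[k] (ℕ × ℕ →₀ V) :=
  (coeffwise x2 - derivT k V ∘ₗ coeffwise w) ∘ₗ scale V (-q⁻¹)

/-- Left multiplication by `u` on `V`-valued polynomials in `z` and `T`. -/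
def opU (q : k) (u w t : V →ₗ[k] V) : (ℕ × ℕ →₀ V) →ₗ[k] (ℕ × ℕ →₀ V) :=
  (coeffwise u - derivZ k V ∘ₗ coeffwise w - derivT k V ∘ₗ coeffwise t +
    (2 : k)⁻¹ • mulT k V ∘ₗ derivT k V ∘ₗ derivT k V ∘ₗ coeffwise w) ∘ₗ scale V (-q⁻¹)

/-- Left multiplication by `w` on `V`-valued polynomials in `z` and `T`. -/
def opW (q : k) (w : V →ₗ[k] V) : (ℕ × ℕ →₀ V) →ₗ[k] (ℕ × ℕ →₀ V) :=
  coeffwise w ∘ₗ scale V (-q⁻¹)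

/-- Left multiplication by `t` on `V`-valued polynomials in `z` and `T`. -/
def opT (q : k) (w t : V →ₗ[k] V) : (ℕ × ℕ →₀ V) →ₗ[k] (ℕ × ℕ →₀ V) :=
  (coeffwise t -
    (mulZ k V ∘ₗ derivZ k V + mulT k V ∘ₗ derivT k V) ∘ₗ coeffwise w) ∘ₗ scale V (-q⁻¹)

variable (k V) in
/-- Left multiplication by `T` on `V`-valued polynomials in `z` and `T`. -/
def opBigT : (ℕ × ℕ →₀ V) →ₗ[k] (ℕ × ℕ →₀ V) :=
  mulT k V - (2 : k)⁻¹ • mulZ k V ∘ₗ mulZ k V ∘ₗ derivZ k V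

lemma extend [CharZero k] (hq : q ≠ 0) (h : ExtJordan q x2 u w t) :
    JordanTower q (opX2 q x2 w) (opU q u w t) (opW q w) (opT q w t) (mulZ k V) (opBigT k V) := by
  have hr : -q⁻¹ ≠ 0 := by simpa
  have h' := h.coeffwise
  have rules := And.intro (mulT_mulZ (k := k) (V := V)) <|
    And.intro (derivZ_mulZ (k := k) (V := V)) <| And.intro (derivT_mulT (k := k) (V := V)) <|
    And.intro (derivZ_mulT (k := k) (V := V)) <| And.intro (derivT_mulZ (k := k) (V := V)) <|
    And.intro (derivT_derivZ (k := k) (V := V)) <|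
    And.intro (fun p => scale_mulZ (V := V) p (-q⁻¹)) <|
    And.intro (fun p => scale_mulT (V := V) p (-q⁻¹)) <|
    And.intro (fun p => scale_derivZ (V := V) p hr) (fun p => scale_derivT (V := V) p hr)
  refine ⟨⟨⟨?_, ?_⟩, ?_, ?_, ?_, ?_, ?_, ?_, ?_⟩, ?_, ?_, ?_, ?_, ?_, ?_, ?_, ?_, ?_⟩
  all_goals
    intro v
    simp only [opX2, opU, opW, opT, opBigT, LinearMap.comp_apply, LinearMap.sub_apply,
      LinearMap.add_apply, LinearMap.smul_apply, map_add, map_sub, map_smul, map_neg, map_zero,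
      rules, coeffwise_mulZ, coeffwise_mulT, coeffwise_derivZ, coeffwise_derivT, coeffwise_scale,
      h'.x2_x2, h'.u_u_x2, h'.w_x2, h'.w_u, h'.t_x2, h'.t_u, h'.w_w, h'.t_t, h'.t_w] <;>
    match_scalars <;> field_simp <;> ring1

end JordanTower

/-- The defining relations of the Nichols algebra, imposed on elements of an arbitrary algebra. -/
structure NicholsRel {A : Type*} [Ring A] [Algebra k A] (q : k) (x1 y x2 u z T s t w : A) :
    Prop where
  z_def : z = y * x2 - q • (x2 * y)
  T_def : T = y * u - q • ((u + x2) * y)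
  s_def : s = u * x2 + x2 * u
  t_def : t = T * u + q • (u * T)
  w_def : w = T * x2 + q • (x2 * T)
  x1_x1 : x1 * x1 = 0
  y_y : y * y = 0
  x1_y : x1 * y = -(y * x1)
  x1_x2 : x1 * x2 = q • (x2 * x1)
  x2_x2 : x2 * x2 = 0
  z_x2 : z * x2 = -(q • (x2 * z))
  x1_u : x1 * u = q • ((u + x2) * x1) + z
  z_u : z * u = w - q • (u * z)
  t_u : t * u = q • ((u - x2) * t)
  y_t : y * t = -(q ^ 2 • ((t + (2 : k) • w) * y)) - q • (z * T)
  w_u : w * u = q • ((u - x2) * w)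
  T_z : T * z = z * T - (2 : k)⁻¹ • (z * z)
  u_s : u * s = s * u + x2 * s

namespace JordanTower

/-- Left multiplication by `x1` on `(V ⊕ yV) ⊕ x1(V ⊕ yV)`. -/
def extX1 : (V × V) × (V × V) →ₗ[k] (V × V) × (V × V) where
  toFun a := ((0, 0), a.1)
  map_add' a b := by ext <;> simp
  map_smul' c a := by ext <;> simp

/-- Left multiplication by `y` on `(V ⊕ yV) ⊕ x1(V ⊕ yV)`. -/
def extY : (V × V) × (V × V) →ₗ[k] (V × V) × (V × V) where
  toFun a := ((0, a.1.1), (0, -a.2.1))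
  map_add' a b := by ext <;> simp; abel
  map_smul' c a := by ext <;> simp

/-- Left multiplication by `x2` on `(V ⊕ yV) ⊕ x1(V ⊕ yV)`. -/
def extX2 (q : k) (x2 z : V →ₗ[k] V) : (V × V) × (V × V) →ₗ[k] (V × V) × (V × V) where
  toFun a := ((x2 a.1.1 - q⁻¹ • z a.1.2, q⁻¹ • x2 a.1.2),
    (q⁻¹ • x2 a.2.1 - (q⁻¹ ^ 2) • z a.2.2, (q⁻¹ ^ 2) • x2 a.2.2))
  map_add' a b := by ext <;> simp <;> module
  map_smul' c a := by ext <;> simp <;> module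

/-- Left multiplication by `u` on `(V ⊕ yV) ⊕ x1(V ⊕ yV)`. -/
def extU (q : k) (x2 u z T : V →ₗ[k] V) : (V × V) × (V × V) →ₗ[k] (V × V) × (V × V) where
  toFun a := ((u a.1.1 + q⁻¹ • (z a.1.2 - T a.1.2 - z a.2.1),
      q⁻¹ • (u a.1.2 - x2 a.1.2) + q⁻¹ ^ 2 • z a.2.2),
    (q⁻¹ • (u a.2.1 - x2 a.2.1) + q⁻¹ ^ 2 • ((2 : k) • z a.2.2 - T a.2.2),
      (q⁻¹ ^ 2) • (u a.2.2 - (2 : k) • x2 a.2.2)))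
  map_add' a b := by ext <;> simp <;> module
  map_smul' c a := by ext <;> simp <;> module

/-- Left multiplication by `z` on `(V ⊕ yV) ⊕ x1(V ⊕ yV)`. -/
def extZ (q : k) (z : V →ₗ[k] V) : (V × V) × (V × V) →ₗ[k] (V × V) × (V × V) where
  toFun a := ((z a.1.1, -(q⁻¹ • z a.1.2)), (-(q⁻¹ • z a.2.1), q⁻¹ ^ 2 • z a.2.2))
  map_add' a b := by ext <;> simp <;> module
  map_smul' c a := by ext <;> simp <;> module

/-- Left multiplication by `T` on `(V ⊕ yV) ⊕ x1(V ⊕ yV)`. -/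
def extBigT (q : k) (z T : V →ₗ[k] V) : (V × V) × (V × V) →ₗ[k] (V × V) × (V × V) where
  toFun a := ((T a.1.1, -(q⁻¹ • (T a.1.2 - z a.1.2))),
    (-(q⁻¹ • (T a.2.1 - z a.2.1)), q⁻¹ ^ 2 • (T a.2.2 - (2 : k) • z a.2.2)))
  map_add' a b := by ext <;> simp <;> module
  map_smul' c a := by ext <;> simp <;> module

/-- Left multiplication by `w` on `(V ⊕ yV) ⊕ x1(V ⊕ yV)`. -/
def extW (q : k) (w z : V →ₗ[k] V) : (V × V) × (V × V) →ₗ[k] (V × V) × (V × V) where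
  toFun a := ((w a.1.1 - (q⁻¹ * 2⁻¹) • z (z a.1.2), -(q⁻¹ ^ 2 • w a.1.2)),
    (-(q⁻¹ ^ 2 • w a.2.1) + (q⁻¹ ^ 3 * 2⁻¹) • z (z a.2.2), q⁻¹ ^ 4 • w a.2.2))
  map_add' a b := by ext <;> simp <;> module
  map_smul' c a := by ext <;> simp <;> module

/-- Left multiplication by `t` on `(V ⊕ yV) ⊕ x1(V ⊕ yV)`. -/
def extT (q : k) (w t z T : V →ₗ[k] V) : (V × V) × (V × V) →ₗ[k] (V × V) × (V × V) where
  toFun a := ((t a.1.1 - q⁻¹ • (z (T a.1.2) - z (z a.1.2)) - (q⁻¹ * 2⁻¹) • z (z a.2.1),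
      -(q⁻¹ ^ 2 • (t a.1.2 - (2 : k) • w a.1.2)) - (q⁻¹ ^ 3 * 2⁻¹) • z (z a.2.2)),
    (-(q⁻¹ ^ 2 • (t a.2.1 - (2 : k) • w a.2.1)) +
        q⁻¹ ^ 3 • (z (T a.2.2) - (2 : k) • z (z a.2.2)),
      q⁻¹ ^ 4 • (t a.2.2 - (4 : k) • w a.2.2)))
  map_add' a b := by ext <;> simp <;> module
  map_smul' c a := by ext <;> simp <;> module

variable {q : k} {x2 u w t z T : V →ₗ[k] V}

set_option maxHeartbeats 1000000 in
lemma nicholsRel [CharZero k] (hq : q ≠ 0) (h : JordanTower q x2 u w t z T) :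
    NicholsRel (A := Module.End k ((V × V) × (V × V))) q extX1 extY (extX2 q x2 z)
      (extU q x2 u z T) (extZ q z) (extBigT q z T)
      (extU q x2 u z T * extX2 q x2 z + extX2 q x2 z * extU q x2 u z T)
      (extT q w t z T) (extW q w z) := by
  constructor
  case s_def => rfl
  all_goals
    refine LinearMap.ext fun ⟨⟨a, b⟩, ⟨c, d⟩⟩ => ?_
    refine Prod.ext (Prod.ext ?_ ?_) (Prod.ext ?_ ?_) <;>
    simp only [Module.End.mul_apply, LinearMap.add_apply, LinearMap.sub_apply,
      LinearMap.neg_apply, LinearMap.smul_apply, LinearMap.zero_apply, extX1, extY, extX2, extU,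
      extZ, extBigT, extW, extT, LinearMap.coe_mk, AddHom.coe_mk, Prod.fst_add, Prod.snd_add,
      Prod.fst_sub, Prod.snd_sub, Prod.fst_neg, Prod.snd_neg, Prod.smul_fst, Prod.smul_snd,
      Prod.fst_zero, Prod.snd_zero,
      map_add, map_sub, map_smul, map_neg, map_zero, h.x2_x2, h.u_u_x2, h.w_x2, h.w_u, h.t_x2,
      h.t_u, h.w_w, h.t_t, h.t_w, h.z_x2, h.z_u, h.z_w, h.z_t, h.T_x2, h.T_u, h.T_w, h.T_t,
      h.T_z] <;>
    match_scalars <;> (try field_simp) <;> ring1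

end JordanTower

end Layers

section Commutation

variable {k} {q} {A : Type*} [Ring A] [Algebra k A] {x1 y x2 u z T s t w : A}

/-- The relations `NicholsRel` as rewriting rules for left multiplications. -/
structure RewriteRules (q : k) (x1 y x2 u z T s t w : A) : Prop where
  x2_x2 v : x2 * (x2 * v) = 0
  u_x2 v : u * (x2 * v) = s * v - x2 * (u * v)
  u_s v : u * (s * v) = s * (u * v) + x2 * (s * v)
  w_u v : w * (u * v) = q • (u * (w * v) - x2 * (w * v))
  t_u v : t * (u * v) = q • (u * (t * v) - x2 * (t * v))
  z_x2 v : z * (x2 * v) = -(q • (x2 * (z * v)))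
  z_u v : z * (u * v) = w * v - q • (u * (z * v))
  T_x2 v : T * (x2 * v) = w * v - q • (x2 * (T * v))
  T_u v : T * (u * v) = t * v - q • (u * (T * v))
  T_z v : T * (z * v) = z * (T * v) - (2 : k)⁻¹ • (z * (z * v))
  y_x2 v : y * (x2 * v) = z * v + q • (x2 * (y * v))
  y_u v : y * (u * v) = T * v + q • (u * (y * v) + x2 * (y * v))
  y_t v : y * (t * v) = -(q • (z * (T * v))) - q ^ 2 • (t * (y * v) + (2 : k) • (w * (y * v)))
  y_y v : y * (y * v) = 0
  x1_x2 v : x1 * (x2 * v) = q • (x2 * (x1 * v))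
  x1_u v : x1 * (u * v) = z * v + q • (u * (x1 * v) + x2 * (x1 * v))
  x1_y v : x1 * (y * v) = -(y * (x1 * v))
  x1_x1 v : x1 * (x1 * v) = 0

lemma NicholsRel.rewriteRules (h : NicholsRel q x1 y x2 u z T s t w) :
    RewriteRules q x1 y x2 u z T s t w where
  x2_x2 v := by
    have e := congrArg (· * v) h.x2_x2
    simp only [add_mul, sub_mul, neg_mul, smul_mul_assoc, mul_assoc, zero_mul] at e
    linear_combination (norm := module) (1 : k) • e
  u_x2 v := by
    have e := congrArg (· * v) h.s_def
    simp only [add_mul, sub_mul, neg_mul, smul_mul_assoc, mul_assoc, zero_mul] at e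
    linear_combination (norm := module) (-1 : k) • e
  u_s v := by
    have e := congrArg (· * v) h.u_s
    simp only [add_mul, sub_mul, neg_mul, smul_mul_assoc, mul_assoc, zero_mul] at e
    linear_combination (norm := module) (1 : k) • e
  w_u v := by
    have e := congrArg (· * v) h.w_u
    simp only [add_mul, sub_mul, neg_mul, smul_mul_assoc, mul_assoc, zero_mul] at e
    linear_combination (norm := module) (1 : k) • e
  t_u v := by
    have e := congrArg (· * v) h.t_u
    simp only [add_mul, sub_mul, neg_mul, smul_mul_assoc, mul_assoc, zero_mul] at e
    linear_combination (norm := module) (1 : k) • e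
  z_x2 v := by
    have e := congrArg (· * v) h.z_x2
    simp only [add_mul, sub_mul, neg_mul, smul_mul_assoc, mul_assoc, zero_mul] at e
    linear_combination (norm := module) (1 : k) • e
  z_u v := by
    have e := congrArg (· * v) h.z_u
    simp only [add_mul, sub_mul, neg_mul, smul_mul_assoc, mul_assoc, zero_mul] at e
    linear_combination (norm := module) (1 : k) • e
  T_x2 v := by
    have e := congrArg (· * v) h.w_def
    simp only [add_mul, sub_mul, neg_mul, smul_mul_assoc, mul_assoc, zero_mul] at e
    linear_combination (norm := module) (-1 : k) • e
  T_u v := by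
    have e := congrArg (· * v) h.t_def
    simp only [add_mul, sub_mul, neg_mul, smul_mul_assoc, mul_assoc, zero_mul] at e
    linear_combination (norm := module) (-1 : k) • e
  T_z v := by
    have e := congrArg (· * v) h.T_z
    simp only [add_mul, sub_mul, neg_mul, smul_mul_assoc, mul_assoc, zero_mul] at e
    linear_combination (norm := module) (1 : k) • e
  y_x2 v := by
    have e := congrArg (· * v) h.z_def
    simp only [add_mul, sub_mul, neg_mul, smul_mul_assoc, mul_assoc, zero_mul] at e
    linear_combination (norm := module) (-1 : k) • e
  y_u v := by
    have e := congrArg (· * v) h.T_def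
    simp only [add_mul, sub_mul, neg_mul, smul_mul_assoc, mul_assoc, zero_mul] at e
    linear_combination (norm := module) (-1 : k) • e
  y_t v := by
    have e := congrArg (· * v) h.y_t
    simp only [add_mul, sub_mul, neg_mul, smul_mul_assoc, mul_assoc, zero_mul] at e
    linear_combination (norm := module) (1 : k) • e
  y_y v := by
    have e := congrArg (· * v) h.y_y
    simp only [add_mul, sub_mul, neg_mul, smul_mul_assoc, mul_assoc, zero_mul] at e
    linear_combination (norm := module) (1 : k) • e
  x1_x2 v := by
    have e := congrArg (· * v) h.x1_x2
    simp only [add_mul, sub_mul, neg_mul, smul_mul_assoc, mul_assoc, zero_mul] at e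
    linear_combination (norm := module) (1 : k) • e
  x1_u v := by
    have e := congrArg (· * v) h.x1_u
    simp only [add_mul, sub_mul, neg_mul, smul_mul_assoc, mul_assoc, zero_mul] at e
    linear_combination (norm := module) (1 : k) • e
  x1_y v := by
    have e := congrArg (· * v) h.x1_y
    simp only [add_mul, sub_mul, neg_mul, smul_mul_assoc, mul_assoc, zero_mul] at e
    linear_combination (norm := module) (1 : k) • e
  x1_x1 v := by
    have e := congrArg (· * v) h.x1_x1
    simp only [add_mul, sub_mul, neg_mul, smul_mul_assoc, mul_assoc, zero_mul] at e
    linear_combination (norm := module) (1 : k) • e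

/-- The commutation relations that put products of the PBW generators into PBW order. -/
structure PBWRules (q : k) (x1 y x2 u z T s t w : A) : Prop
    extends RewriteRules q x1 y x2 u z T s t w where
  s_x2 v : s * (x2 * v) = x2 * (s * v)
  w_x2 v : w * (x2 * v) = q • (x2 * (w * v))
  y_z v : y * (z * v) = -(q • (z * (y * v)))
  y_T v : y * (T * v) = -(q • (T * (y * v) + z * (y * v)))
  x1_z v : x1 * (z * v) = -(q • (z * (x1 * v)))
  x1_T v : x1 * (T * v) = -(q • (T * (x1 * v) + z * (x1 * v)))
  z_s v : z * (s * v) = q ^ 2 • (s * (z * v))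
  w_s v : w * (s * v) = q ^ 2 • (s * (w * v))
  z_w v : z * (w * v) = -(q • (w * (z * v)))
  y_s v : y * (s * v) = (2 : k) • (w * v) + q ^ 2 • (s * (y * v)) + q • (x2 * (z * v))
  x1_s v : x1 * (s * v) = q ^ 2 • (s * (x1 * v))
  x1_w v : x1 * (w * v) = -(q ^ 2 • (w * (x1 * v)))
  y_w v : y * (w * v) = -((q * 2⁻¹) • (z * (z * v))) - q ^ 2 • (w * (y * v))
  x1_t v : x1 * (t * v) = -((q * 2⁻¹) • (z * (z * v))) -
    q ^ 2 • (t * (x1 * v) + (2 : k) • (w * (x1 * v)))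
  T_w v : T * (w * v) = -(q • (w * (T * v)))
  z_t v : z * (t * v) = -(q • (t * (z * v) + w * (z * v)))
  T_s v : T * (s * v) = q ^ 2 • (s * (T * v)) - q • (x2 * (w * v))
  t_x2 v : t * (x2 * v) = q • (x2 * (t * v))
  t_s v : t * (s * v) = q ^ 2 • (s * (t * v))
  T_t v : T * (t * v) = -(q • (t * (T * v) + w * (T * v)))
  w_w v : w * (w * v) = 0
  t_w v : t * (w * v) = -(w * (t * v))
  t_t v : t * (t * v) = 0

lemma RewriteRules.pbwRules [CharZero k] (hq : q ≠ 0) (h : RewriteRules q x1 y x2 u z T s t w) :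
    PBWRules q x1 y x2 u z T s t w := by
  have s_x2 v : s * (x2 * v) = x2 * (s * v) := by
    have e := (congrArg (u * ·) (h.x2_x2 v)).symm.trans (h.u_x2 (x2 * v))
    simp only [mul_add, mul_sub, mul_neg, mul_smul_comm, mul_zero, h.x2_x2, h.u_x2, h.u_s,
      h.w_u, h.t_u, h.z_x2, h.z_u, h.T_x2, h.T_u, h.T_z, h.y_x2, h.y_u, h.y_t, h.y_y, h.x1_x2,
      h.x1_u, h.x1_y, h.x1_x1] at e
    linear_combination (norm := skip) (-1 : k) • e
    match_scalars <;> (try field_simp) <;> ring1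
  have w_x2 v : w * (x2 * v) = q • (x2 * (w * v)) := by
    have e := (congrArg (T * ·) (h.x2_x2 v)).symm.trans (h.T_x2 (x2 * v))
    simp only [mul_add, mul_sub, mul_neg, mul_smul_comm, mul_zero, h.x2_x2, h.u_x2, h.u_s,
      h.w_u, h.t_u, h.z_x2, h.z_u, h.T_x2, h.T_u, h.T_z, h.y_x2, h.y_u, h.y_t, h.y_y, h.x1_x2,
      h.x1_u, h.x1_y, h.x1_x1, s_x2] at e
    linear_combination (norm := skip) (-1 : k) • e
    match_scalars <;> (try field_simp) <;> ring1
  have y_z v : y * (z * v) = -(q • (z * (y * v))) := by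
    have e := (congrArg (y * ·) (h.y_x2 v)).symm.trans (h.y_y (x2 * v))
    simp only [mul_add, mul_sub, mul_neg, mul_smul_comm, mul_zero, h.x2_x2, h.u_x2, h.u_s,
      h.w_u, h.t_u, h.z_x2, h.z_u, h.T_x2, h.T_u, h.T_z, h.y_x2, h.y_u, h.y_t, h.y_y, h.x1_x2,
      h.x1_u, h.x1_y, h.x1_x1, s_x2, w_x2] at e
    linear_combination (norm := skip) (1 : k) • e
    match_scalars <;> (try field_simp) <;> ring1
  have y_T v : y * (T * v) = -(q • (T * (y * v) + z * (y * v))) := by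
    have e := (congrArg (y * ·) (h.y_u v)).symm.trans (h.y_y (u * v))
    simp only [mul_add, mul_sub, mul_neg, mul_smul_comm, mul_zero, h.x2_x2, h.u_x2, h.u_s,
      h.w_u, h.t_u, h.z_x2, h.z_u, h.T_x2, h.T_u, h.T_z, h.y_x2, h.y_u, h.y_t, h.y_y, h.x1_x2,
      h.x1_u, h.x1_y, h.x1_x1, s_x2, w_x2, y_z] at e
    linear_combination (norm := skip) (1 : k) • e
    match_scalars <;> (try field_simp) <;> ring1
  have x1_z v : x1 * (z * v) = -(q • (z * (x1 * v))) := by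
    have e := (congrArg (x1 * ·) (h.y_x2 v)).symm.trans (h.x1_y (x2 * v))
    simp only [mul_add, mul_sub, mul_neg, mul_smul_comm, mul_zero, h.x2_x2, h.u_x2, h.u_s,
      h.w_u, h.t_u, h.z_x2, h.z_u, h.T_x2, h.T_u, h.T_z, h.y_x2, h.y_u, h.y_t, h.y_y, h.x1_x2,
      h.x1_u, h.x1_y, h.x1_x1, s_x2, w_x2, y_z, y_T] at e
    linear_combination (norm := skip) (1 : k) • e
    match_scalars <;> (try field_simp) <;> ring1
  have x1_T v : x1 * (T * v) = -(q • (T * (x1 * v) + z * (x1 * v))) := by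
    have e := (congrArg (x1 * ·) (h.y_u v)).symm.trans (h.x1_y (u * v))
    simp only [mul_add, mul_sub, mul_neg, mul_smul_comm, mul_zero, h.x2_x2, h.u_x2, h.u_s,
      h.w_u, h.t_u, h.z_x2, h.z_u, h.T_x2, h.T_u, h.T_z, h.y_x2, h.y_u, h.y_t, h.y_y, h.x1_x2,
      h.x1_u, h.x1_y, h.x1_x1, s_x2, w_x2, y_z, y_T, x1_z] at e
    linear_combination (norm := skip) (1 : k) • e
    match_scalars <;> (try field_simp) <;> ring1
  have z_s v : z * (s * v) = q ^ 2 • (s * (z * v)) := by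
    have e := (congrArg (z * ·) (h.u_x2 v)).symm.trans (h.z_u (x2 * v))
    simp only [mul_add, mul_sub, mul_neg, mul_smul_comm, mul_zero, h.x2_x2, h.u_x2, h.u_s,
      h.w_u, h.t_u, h.z_x2, h.z_u, h.T_x2, h.T_u, h.T_z, h.y_x2, h.y_u, h.y_t, h.y_y, h.x1_x2,
      h.x1_u, h.x1_y, h.x1_x1, s_x2, w_x2, y_z, y_T, x1_z, x1_T] at e
    linear_combination (norm := skip) (1 : k) • e
    match_scalars <;> (try field_simp) <;> ring1
  have w_s v : w * (s * v) = q ^ 2 • (s * (w * v)) := by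
    have e := (congrArg (w * ·) (h.u_x2 v)).symm.trans (h.w_u (x2 * v))
    simp only [mul_add, mul_sub, mul_neg, mul_smul_comm, mul_zero, h.x2_x2, h.u_x2, h.u_s,
      h.w_u, h.t_u, h.z_x2, h.z_u, h.T_x2, h.T_u, h.T_z, h.y_x2, h.y_u, h.y_t, h.y_y, h.x1_x2,
      h.x1_u, h.x1_y, h.x1_x1, s_x2, w_x2, y_z, y_T, x1_z, x1_T, z_s] at e
    linear_combination (norm := skip) (1 : k) • e
    match_scalars <;> (try field_simp) <;> ring1
  have z_w v : z * (w * v) = -(q • (w * (z * v))) := by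
    have e := (congrArg (T * ·) (h.z_x2 v)).symm.trans (h.T_z (x2 * v))
    simp only [mul_add, mul_sub, mul_neg, mul_smul_comm, mul_zero, h.x2_x2, h.u_x2, h.u_s,
      h.w_u, h.t_u, h.z_x2, h.z_u, h.T_x2, h.T_u, h.T_z, h.y_x2, h.y_u, h.y_t, h.y_y, h.x1_x2,
      h.x1_u, h.x1_y, h.x1_x1, s_x2, w_x2, y_z, y_T, x1_z, x1_T, z_s, w_s] at e
    linear_combination (norm := skip) (-1 : k) • e
    match_scalars <;> (try field_simp) <;> ring1
  have y_s v : y * (s * v) = (2 : k) • (w * v) + q ^ 2 • (s * (y * v)) + q • (x2 * (z * v)) := by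
    have e := (congrArg (y * ·) (h.u_x2 v)).symm.trans (h.y_u (x2 * v))
    simp only [mul_add, mul_sub, mul_neg, mul_smul_comm, mul_zero, h.x2_x2, h.u_x2, h.u_s,
      h.w_u, h.t_u, h.z_x2, h.z_u, h.T_x2, h.T_u, h.T_z, h.y_x2, h.y_u, h.y_t, h.y_y, h.x1_x2,
      h.x1_u, h.x1_y, h.x1_x1, s_x2, w_x2, y_z, y_T, x1_z, x1_T, z_s, w_s, z_w] at e
    linear_combination (norm := skip) (1 : k) • e
    match_scalars <;> (try field_simp) <;> ring1
  have x1_s v : x1 * (s * v) = q ^ 2 • (s * (x1 * v)) := by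
    have e := (congrArg (x1 * ·) (h.u_x2 v)).symm.trans (h.x1_u (x2 * v))
    simp only [mul_add, mul_sub, mul_neg, mul_smul_comm, mul_zero, h.x2_x2, h.u_x2, h.u_s,
      h.w_u, h.t_u, h.z_x2, h.z_u, h.T_x2, h.T_u, h.T_z, h.y_x2, h.y_u, h.y_t, h.y_y, h.x1_x2,
      h.x1_u, h.x1_y, h.x1_x1, s_x2, w_x2, y_z, y_T, x1_z, x1_T, z_s, w_s, z_w, y_s] at e
    linear_combination (norm := skip) (1 : k) • e
    match_scalars <;> (try field_simp) <;> ring1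
  have x1_w v : x1 * (w * v) = -(q ^ 2 • (w * (x1 * v))) := by
    have e := (congrArg (x1 * ·) (h.z_u v)).symm.trans (x1_z (u * v))
    simp only [mul_add, mul_sub, mul_neg, mul_smul_comm, mul_zero, h.x2_x2, h.u_x2, h.u_s,
      h.w_u, h.t_u, h.z_x2, h.z_u, h.T_x2, h.T_u, h.T_z, h.y_x2, h.y_u, h.y_t, h.y_y, h.x1_x2,
      h.x1_u, h.x1_y, h.x1_x1, s_x2, w_x2, y_z, y_T, x1_z, x1_T, z_s, w_s, z_w, y_s, x1_s] at e
    linear_combination (norm := skip) (1 : k) • e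
    match_scalars <;> (try field_simp) <;> ring1
  have y_w v : y * (w * v) = -((q * 2⁻¹) • (z * (z * v))) - q ^ 2 • (w * (y * v)) := by
    have e := (congrArg (y * ·) (h.T_x2 v)).symm.trans (y_T (x2 * v))
    simp only [mul_add, mul_sub, mul_neg, mul_smul_comm, mul_zero, h.x2_x2, h.u_x2, h.u_s,
      h.w_u, h.t_u, h.z_x2, h.z_u, h.T_x2, h.T_u, h.T_z, h.y_x2, h.y_u, h.y_t, h.y_y, h.x1_x2,
      h.x1_u, h.x1_y, h.x1_x1, s_x2, w_x2, y_z, y_T, x1_z, x1_T, z_s, w_s, z_w, y_s, x1_s, x1_w]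
      at e
    linear_combination (norm := skip) (1 : k) • e
    match_scalars <;> (try field_simp) <;> ring1
  have x1_t v : x1 * (t * v) = -((q * 2⁻¹) • (z * (z * v))) -
      q ^ 2 • (t * (x1 * v) + (2 : k) • (w * (x1 * v))) := by
    have e := (congrArg (x1 * ·) (h.T_u v)).symm.trans (x1_T (u * v))
    simp only [mul_add, mul_sub, mul_neg, mul_smul_comm, mul_zero, h.x2_x2, h.u_x2, h.u_s,
      h.w_u, h.t_u, h.z_x2, h.z_u, h.T_x2, h.T_u, h.T_z, h.y_x2, h.y_u, h.y_t, h.y_y, h.x1_x2,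
      h.x1_u, h.x1_y, h.x1_x1, s_x2, w_x2, y_z, y_T, x1_z, x1_T, z_s, w_s, z_w, y_s, x1_s, x1_w,
      y_w] at e
    linear_combination (norm := skip) (1 : k) • e
    match_scalars <;> (try field_simp) <;> ring1
  have T_w v : T * (w * v) = -(q • (w * (T * v))) := by
    have e := (congrArg (y * ·) (h.w_u v)).symm.trans (y_w (u * v))
    simp only [mul_add, mul_sub, mul_neg, mul_smul_comm, mul_zero, h.x2_x2, h.u_x2, h.u_s,
      h.w_u, h.t_u, h.z_x2, h.z_u, h.T_x2, h.T_u, h.T_z, h.y_x2, h.y_u, h.y_t, h.y_y, h.x1_x2,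
      h.x1_u, h.x1_y, h.x1_x1, s_x2, w_x2, y_z, y_T, x1_z, x1_T, z_s, w_s, z_w, y_s, x1_s, x1_w,
      y_w, x1_t] at e
    linear_combination (norm := skip) (q⁻¹ : k) • e
    match_scalars <;> (try field_simp) <;> ring1
  have z_t v : z * (t * v) = -(q • (t * (z * v) + w * (z * v))) := by
    have e := (congrArg (T * ·) (h.z_u v)).symm.trans (h.T_z (u * v))
    simp only [mul_add, mul_sub, mul_neg, mul_smul_comm, mul_zero, h.x2_x2, h.u_x2, h.u_s,
      h.w_u, h.t_u, h.z_x2, h.z_u, h.T_x2, h.T_u, h.T_z, h.y_x2, h.y_u, h.y_t, h.y_y, h.x1_x2,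
      h.x1_u, h.x1_y, h.x1_x1, s_x2, w_x2, y_z, y_T, x1_z, x1_T, z_s, w_s, z_w, y_s, x1_s, x1_w,
      y_w, x1_t, T_w] at e
    linear_combination (norm := skip) (-1 : k) • e
    match_scalars <;> (try field_simp) <;> ring1
  have T_s v : T * (s * v) = q ^ 2 • (s * (T * v)) - q • (x2 * (w * v)) := by
    have e := (congrArg (y * ·) (h.u_s v)).symm.trans (h.y_u (s * v))
    simp only [mul_add, mul_sub, mul_neg, mul_smul_comm, mul_zero, h.x2_x2, h.u_x2, h.u_s,
      h.w_u, h.t_u, h.z_x2, h.z_u, h.T_x2, h.T_u, h.T_z, h.y_x2, h.y_u, h.y_t, h.y_y, h.x1_x2,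
      h.x1_u, h.x1_y, h.x1_x1, s_x2, w_x2, y_z, y_T, x1_z, x1_T, z_s, w_s, z_w, y_s, x1_s, x1_w,
      y_w, x1_t, T_w, z_t] at e
    linear_combination (norm := skip) (-1 : k) • e
    match_scalars <;> (try field_simp) <;> ring1
  have t_x2 v : t * (x2 * v) = q • (x2 * (t * v)) := by
    have e := (congrArg (T * ·) (h.u_x2 v)).symm.trans (h.T_u (x2 * v))
    simp only [mul_add, mul_sub, mul_neg, mul_smul_comm, mul_zero, h.x2_x2, h.u_x2, h.u_s,
      h.w_u, h.t_u, h.z_x2, h.z_u, h.T_x2, h.T_u, h.T_z, h.y_x2, h.y_u, h.y_t, h.y_y, h.x1_x2,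
      h.x1_u, h.x1_y, h.x1_x1, s_x2, w_x2, y_z, y_T, x1_z, x1_T, z_s, w_s, z_w, y_s, x1_s, x1_w,
      y_w, x1_t, T_w, z_t, T_s] at e
    linear_combination (norm := skip) (-1 : k) • e
    match_scalars <;> (try field_simp) <;> ring1
  have t_s v : t * (s * v) = q ^ 2 • (s * (t * v)) := by
    have e := (congrArg (t * ·) (h.u_x2 v)).symm.trans (h.t_u (x2 * v))
    simp only [mul_add, mul_sub, mul_neg, mul_smul_comm, mul_zero, h.x2_x2, h.u_x2, h.u_s,
      h.w_u, h.t_u, h.z_x2, h.z_u, h.T_x2, h.T_u, h.T_z, h.y_x2, h.y_u, h.y_t, h.y_y, h.x1_x2,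
      h.x1_u, h.x1_y, h.x1_x1, s_x2, w_x2, y_z, y_T, x1_z, x1_T, z_s, w_s, z_w, y_s, x1_s, x1_w,
      y_w, x1_t, T_w, z_t, T_s, t_x2] at e
    linear_combination (norm := skip) (1 : k) • e
    match_scalars <;> (try field_simp) <;> ring1
  have T_t v : T * (t * v) = -(q • (t * (T * v) + w * (T * v))) := by
    have e := (congrArg (y * ·) (h.t_u v)).symm.trans (h.y_t (u * v))
    simp only [mul_add, mul_sub, mul_neg, mul_smul_comm, mul_zero, h.x2_x2, h.u_x2, h.u_s,
      h.w_u, h.t_u, h.z_x2, h.z_u, h.T_x2, h.T_u, h.T_z, h.y_x2, h.y_u, h.y_t, h.y_y, h.x1_x2,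
      h.x1_u, h.x1_y, h.x1_x1, s_x2, w_x2, y_z, y_T, x1_z, x1_T, z_s, w_s, z_w, y_s, x1_s, x1_w,
      y_w, x1_t, T_w, z_t, T_s, t_x2, t_s] at e
    linear_combination (norm := skip) (q⁻¹ : k) • e
    match_scalars <;> (try field_simp) <;> ring1
  have w_w v : w * (w * v) = 0 := by
    have e := (congrArg (z * ·) (h.w_u v)).symm.trans (z_w (u * v))
    simp only [mul_add, mul_sub, mul_neg, mul_smul_comm, mul_zero, h.x2_x2, h.u_x2, h.u_s,
      h.w_u, h.t_u, h.z_x2, h.z_u, h.T_x2, h.T_u, h.T_z, h.y_x2, h.y_u, h.y_t, h.y_y, h.x1_x2,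
      h.x1_u, h.x1_y, h.x1_x1, s_x2, w_x2, y_z, y_T, x1_z, x1_T, z_s, w_s, z_w, y_s, x1_s, x1_w,
      y_w, x1_t, T_w, z_t, T_s, t_x2, t_s, T_t] at e
    linear_combination (norm := skip) ((2 * q)⁻¹ : k) • e
    match_scalars <;> (try field_simp) <;> ring1
  have t_w v : t * (w * v) = -(w * (t * v)) := by
    have e := (congrArg (T * ·) (h.w_u v)).symm.trans (T_w (u * v))
    simp only [mul_add, mul_sub, mul_neg, mul_smul_comm, mul_zero, h.x2_x2, h.u_x2, h.u_s,
      h.w_u, h.t_u, h.z_x2, h.z_u, h.T_x2, h.T_u, h.T_z, h.y_x2, h.y_u, h.y_t, h.y_y, h.x1_x2,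
      h.x1_u, h.x1_y, h.x1_x1, s_x2, w_x2, y_z, y_T, x1_z, x1_T, z_s, w_s, z_w, y_s, x1_s, x1_w,
      y_w, x1_t, T_w, z_t, T_s, t_x2, t_s, T_t, w_w] at e
    linear_combination (norm := skip) (q⁻¹ : k) • e
    match_scalars <;> (try field_simp) <;> ring1
  have t_t v : t * (t * v) = 0 := by
    have e := (congrArg (T * ·) (h.t_u v)).symm.trans (T_t (u * v))
    simp only [mul_add, mul_sub, mul_neg, mul_smul_comm, mul_zero, h.x2_x2, h.u_x2, h.u_s,
      h.w_u, h.t_u, h.z_x2, h.z_u, h.T_x2, h.T_u, h.T_z, h.y_x2, h.y_u, h.y_t, h.y_y, h.x1_x2,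
      h.x1_u, h.x1_y, h.x1_x1, s_x2, w_x2, y_z, y_T, x1_z, x1_T, z_s, w_s, z_w, y_s, x1_s, x1_w,
      y_w, x1_t, T_w, z_t, T_s, t_x2, t_s, T_t, w_w, t_w] at e
    linear_combination (norm := skip) ((2 * q)⁻¹ : k) • e
    match_scalars <;> (try field_simp) <;> ring1
  exact { h with
    s_x2, w_x2, y_z, y_T, x1_z, x1_T, z_s, w_s, z_w, y_s, x1_s, x1_w, y_w,
    x1_t, T_w, z_t, T_s, t_x2, t_s, T_t, w_w, t_w, t_t }

end Commutation

section Spanning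

variable {k} {A : Type*} [Ring A] [Algebra k A]

open Algebra (adjoin)

/-- If `X` can be moved to the right of the generators of an algebra, then adjoining `X` to this
algebra only requires products of its elements with powers of `X` on the right. -/
lemma adjoin_insert_le {X : A} {G : Set A} {P Q : Submodule k A}
    (hP : (adjoin k G).toSubmodule ≤ P) (hQ : ∀ n : ℕ, X ^ n ∈ Q)
    (hX : ∀ g ∈ G, ∃ a ∈ adjoin k G, ∃ b ∈ adjoin k G, ∀ v, X * (g * v) = a * (X * v) + b * v) :
    (adjoin k (insert X G)).toSubmodule ≤ P * Q := by
  have move : ∀ g ∈ adjoin k G, ∃ a ∈ adjoin k G, ∃ b ∈ adjoin k G, X * g = a * X + b := by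
    intro g hg
    induction hg using Algebra.adjoin_induction with
    | mem g hg =>
      obtain ⟨a, ha, b, hb, e⟩ := hX g hg
      exact ⟨a, ha, b, hb, by simpa using e 1⟩
    | algebraMap r =>
      exact ⟨_, algebraMap_mem _ r, 0, zero_mem _, by rw [add_zero, Algebra.commutes]⟩
    | add g g' _ _ ih ih' =>
      obtain ⟨a, ha, b, hb, e⟩ := ih
      obtain ⟨a', ha', b', hb', e'⟩ := ih'
      exact ⟨_, add_mem ha ha', _, add_mem hb hb', by rw [mul_add, e, e']; noncomm_ring⟩
    | mul g g' _ hg' ih ih' =>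
      obtain ⟨a, ha, b, hb, e⟩ := ih
      obtain ⟨a', ha', b', hb', e'⟩ := ih'
      refine ⟨_, mul_mem ha ha', _, add_mem (mul_mem ha hb') (mul_mem hb hg'), ?_⟩
      rw [← mul_assoc, e, add_mul, mul_assoc, e']
      noncomm_ring
  have stable : ∀ g ∈ adjoin k (insert X G),
      ∀ p ∈ (adjoin k G).toSubmodule * Submodule.span k (Set.range fun n : ℕ => X ^ n),
        g * p ∈ (adjoin k G).toSubmodule * Submodule.span k (Set.range fun n : ℕ => X ^ n) := by
    intro g hg
    induction hg using Algebra.adjoin_induction with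
    | mem g hg =>
      intro p hp
      induction hp using Submodule.mul_induction_on' with
      | mem_mul_mem c hc r hr =>
        rcases hg with rfl | hg
        · obtain ⟨a, ha, b, hb, e⟩ := move c hc
          rw [← mul_assoc, e, add_mul, mul_assoc]
          refine add_mem (Submodule.mul_mem_mul ha ?_) (Submodule.mul_mem_mul hb hr)
          induction hr using Submodule.span_induction with
          | mem r hr =>
            obtain ⟨n, rfl⟩ := hr
            exact Submodule.subset_span ⟨n + 1, pow_succ' g n⟩
          | zero => simp
          | add r r' _ _ ih ih' => rw [mul_add]; exact add_mem ih ih'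
          | smul c r _ ih => rw [mul_smul_comm]; exact Submodule.smul_mem _ _ ih
        · rw [← mul_assoc]
          exact Submodule.mul_mem_mul
            (mul_mem (S := Subalgebra k A) (Algebra.subset_adjoin hg) hc) hr
      | add p _ p' _ ih ih' => rw [mul_add]; exact add_mem ih ih'
    | algebraMap r =>
      intro p hp
      rw [← Algebra.smul_def]
      exact Submodule.smul_mem _ _ hp
    | add g g' _ _ ih ih' =>
      intro p hp
      rw [add_mul]
      exact add_mem (ih p hp) (ih' p hp)
    | mul g g' _ _ ih ih' =>
      intro p hp
      rw [mul_assoc]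
      exact ih _ (ih' p hp)
  intro g hg
  refine mul_le_mul' hP (Submodule.span_le.2 (Set.range_subset_iff.2 hQ)) ?_
  rw [← mul_one g]
  refine stable g hg 1 ?_
  rw [← mul_one (1 : A)]
  exact Submodule.mul_mem_mul (one_mem (adjoin k G)) (Submodule.subset_span ⟨0, pow_zero X⟩)

lemma pow_mem_span_range (X : A) (n : ℕ) :
    X ^ n ∈ Submodule.span k (Set.range fun m : ℕ => X ^ m) :=
  Submodule.subset_span ⟨n, rfl⟩

lemma pow_mem_span_range_fin_two {X : A} (h : ∀ v, X * (X * v) = 0) (n : ℕ) :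
    X ^ n ∈ Submodule.span k (Set.range fun m : Fin 2 => X ^ (m : ℕ)) := by
  match n with
  | 0 => exact Submodule.subset_span ⟨0, rfl⟩
  | 1 => exact Submodule.subset_span ⟨1, rfl⟩
  | n + 2 =>
    rw [pow_add, sq, (Commute.pow_left (.mul_right (.refl X) (.refl X)) n).eq, mul_assoc, h]
    exact zero_mem _

variable {q} {x1 y x2 u z T s t w : A}

lemma PBWRules.span_eq_top (h : PBWRules q x1 y x2 u z T s t w)
    (hA : adjoin k {x1, y, x2, u} = ⊤) :
    Submodule.span k (Set.range fun i : Idx => x2 ^ (i.m1 : ℕ) * s ^ i.m2 * u ^ i.m3 *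
      w ^ (i.m4 : ℕ) * t ^ (i.m5 : ℕ) * z ^ i.m6 * T ^ i.m7 * y ^ (i.m8 : ℕ) *
        x1 ^ (i.m9 : ℕ)) = ⊤ := by
  have h0 : (adjoin k (∅ : Set A)).toSubmodule ≤ 1 := by
    rw [Algebra.adjoin_empty, Algebra.toSubmodule_bot]
  have hx2 := adjoin_insert_le h0 (pow_mem_span_range_fin_two (k := k) h.x2_x2) <| by
    simp only [Set.mem_empty_iff_false, IsEmpty.forall_iff, implies_true]
  have hs := adjoin_insert_le hx2 (pow_mem_span_range (k := k) s) <| by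
    simp only [Set.forall_mem_insert, Set.mem_empty_iff_false, IsEmpty.forall_iff, implies_true,
      and_true]
    refine ⟨x2, ?_, 0, ?_, fun v => (h.s_x2 v).trans ?_⟩
    all_goals repeat' first
      | exact zero_mem _ | apply add_mem | apply sub_mem | apply neg_mem | apply Subalgebra.smul_mem
      | apply mul_mem | exact Algebra.subset_adjoin (by simp)
    all_goals simp only [add_mul, sub_mul, neg_mul, smul_mul_assoc, mul_assoc, zero_mul]
    all_goals module
  have hu := adjoin_insert_le hs (pow_mem_span_range (k := k) u) <| by
    simp only [Set.forall_mem_insert, Set.mem_empty_iff_false, IsEmpty.forall_iff, implies_true,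
      and_true]
    refine ⟨⟨s, ?_, x2 * s, ?_, fun v => (h.u_s v).trans ?_⟩,
      ⟨-x2, ?_, s, ?_, fun v => (h.u_x2 v).trans ?_⟩⟩
    all_goals repeat' first
      | exact zero_mem _ | apply add_mem | apply sub_mem | apply neg_mem | apply Subalgebra.smul_mem
      | apply mul_mem | exact Algebra.subset_adjoin (by simp)
    all_goals simp only [add_mul, sub_mul, neg_mul, smul_mul_assoc, mul_assoc, zero_mul]
    all_goals module
  have hw := adjoin_insert_le hu (pow_mem_span_range_fin_two (k := k) h.w_w) <| by
    simp only [Set.forall_mem_insert, Set.mem_empty_iff_false, IsEmpty.forall_iff, implies_true,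
      and_true]
    refine ⟨⟨q • (u - x2), ?_, 0, ?_, fun v => (h.w_u v).trans ?_⟩,
      ⟨q ^ 2 • s, ?_, 0, ?_, fun v => (h.w_s v).trans ?_⟩,
      ⟨q • x2, ?_, 0, ?_, fun v => (h.w_x2 v).trans ?_⟩⟩
    all_goals repeat' first
      | exact zero_mem _ | apply add_mem | apply sub_mem | apply neg_mem | apply Subalgebra.smul_mem
      | apply mul_mem | exact Algebra.subset_adjoin (by simp)
    all_goals simp only [add_mul, sub_mul, neg_mul, smul_mul_assoc, mul_assoc, zero_mul]
    all_goals module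
  have ht := adjoin_insert_le hw (pow_mem_span_range_fin_two (k := k) h.t_t) <| by
    simp only [Set.forall_mem_insert, Set.mem_empty_iff_false, IsEmpty.forall_iff, implies_true,
      and_true]
    refine ⟨⟨-w, ?_, 0, ?_, fun v => (h.t_w v).trans ?_⟩,
      ⟨q • (u - x2), ?_, 0, ?_, fun v => (h.t_u v).trans ?_⟩,
      ⟨q ^ 2 • s, ?_, 0, ?_, fun v => (h.t_s v).trans ?_⟩,
      ⟨q • x2, ?_, 0, ?_, fun v => (h.t_x2 v).trans ?_⟩⟩
    all_goals repeat' first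
      | exact zero_mem _ | apply add_mem | apply sub_mem | apply neg_mem | apply Subalgebra.smul_mem
      | apply mul_mem | exact Algebra.subset_adjoin (by simp)
    all_goals simp only [add_mul, sub_mul, neg_mul, smul_mul_assoc, mul_assoc, zero_mul]
    all_goals module
  have hz := adjoin_insert_le ht (pow_mem_span_range (k := k) z) <| by
    simp only [Set.forall_mem_insert, Set.mem_empty_iff_false, IsEmpty.forall_iff, implies_true,
      and_true]
    refine ⟨⟨-(q • (t + w)), ?_, 0, ?_, fun v => (h.z_t v).trans ?_⟩,
      ⟨-(q • w), ?_, 0, ?_, fun v => (h.z_w v).trans ?_⟩,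
      ⟨-(q • u), ?_, w, ?_, fun v => (h.z_u v).trans ?_⟩,
      ⟨q ^ 2 • s, ?_, 0, ?_, fun v => (h.z_s v).trans ?_⟩,
      ⟨-(q • x2), ?_, 0, ?_, fun v => (h.z_x2 v).trans ?_⟩⟩
    all_goals repeat' first
      | exact zero_mem _ | apply add_mem | apply sub_mem | apply neg_mem | apply Subalgebra.smul_mem
      | apply mul_mem | exact Algebra.subset_adjoin (by simp)
    all_goals simp only [add_mul, sub_mul, neg_mul, smul_mul_assoc, mul_assoc, zero_mul]
    all_goals module
  have hT := adjoin_insert_le hz (pow_mem_span_range (k := k) T) <| by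
    simp only [Set.forall_mem_insert, Set.mem_empty_iff_false, IsEmpty.forall_iff, implies_true,
      and_true]
    refine ⟨⟨z, ?_, -((2 : k)⁻¹ • (z * z)), ?_, fun v => (h.T_z v).trans ?_⟩,
      ⟨-(q • (t + w)), ?_, 0, ?_, fun v => (h.T_t v).trans ?_⟩,
      ⟨-(q • w), ?_, 0, ?_, fun v => (h.T_w v).trans ?_⟩,
      ⟨-(q • u), ?_, t, ?_, fun v => (h.T_u v).trans ?_⟩,
      ⟨q ^ 2 • s, ?_, -(q • (x2 * w)), ?_, fun v => (h.T_s v).trans ?_⟩,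
      ⟨-(q • x2), ?_, w, ?_, fun v => (h.T_x2 v).trans ?_⟩⟩
    all_goals repeat' first
      | exact zero_mem _ | apply add_mem | apply sub_mem | apply neg_mem | apply Subalgebra.smul_mem
      | apply mul_mem | exact Algebra.subset_adjoin (by simp)
    all_goals simp only [add_mul, sub_mul, neg_mul, smul_mul_assoc, mul_assoc, zero_mul]
    all_goals module
  have hy := adjoin_insert_le hT (pow_mem_span_range_fin_two (k := k) h.y_y) <| by
    simp only [Set.forall_mem_insert, Set.mem_empty_iff_false, IsEmpty.forall_iff, implies_true,
      and_true]
    refine ⟨⟨-(q • (T + z)), ?_, 0, ?_, fun v => (h.y_T v).trans ?_⟩,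
      ⟨-(q • z), ?_, 0, ?_, fun v => (h.y_z v).trans ?_⟩,
      ⟨-(q ^ 2 • (t + (2 : k) • w)), ?_, -(q • (z * T)), ?_, fun v => (h.y_t v).trans ?_⟩,
      ⟨-(q ^ 2 • w), ?_, -((q * 2⁻¹) • (z * z)), ?_, fun v => (h.y_w v).trans ?_⟩,
      ⟨q • (u + x2), ?_, T, ?_, fun v => (h.y_u v).trans ?_⟩,
      ⟨q ^ 2 • s, ?_, (2 : k) • w + q • (x2 * z), ?_, fun v => (h.y_s v).trans ?_⟩,
      ⟨q • x2, ?_, z, ?_, fun v => (h.y_x2 v).trans ?_⟩⟩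
    all_goals repeat' first
      | exact zero_mem _ | apply add_mem | apply sub_mem | apply neg_mem | apply Subalgebra.smul_mem
      | apply mul_mem | exact Algebra.subset_adjoin (by simp)
    all_goals simp only [add_mul, sub_mul, neg_mul, smul_mul_assoc, mul_assoc, zero_mul]
    all_goals module
  have hx1 := adjoin_insert_le hy (pow_mem_span_range_fin_two (k := k) h.x1_x1) <| by
    simp only [Set.forall_mem_insert, Set.mem_empty_iff_false, IsEmpty.forall_iff, implies_true,
      and_true]
    refine ⟨⟨-y, ?_, 0, ?_, fun v => (h.x1_y v).trans ?_⟩,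
      ⟨-(q • (T + z)), ?_, 0, ?_, fun v => (h.x1_T v).trans ?_⟩,
      ⟨-(q • z), ?_, 0, ?_, fun v => (h.x1_z v).trans ?_⟩,
      ⟨-(q ^ 2 • (t + (2 : k) • w)), ?_, -((q * 2⁻¹) • (z * z)), ?_, fun v => (h.x1_t v).trans ?_⟩,
      ⟨-(q ^ 2 • w), ?_, 0, ?_, fun v => (h.x1_w v).trans ?_⟩,
      ⟨q • (u + x2), ?_, z, ?_, fun v => (h.x1_u v).trans ?_⟩,
      ⟨q ^ 2 • s, ?_, 0, ?_, fun v => (h.x1_s v).trans ?_⟩,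
      ⟨q • x2, ?_, 0, ?_, fun v => (h.x1_x2 v).trans ?_⟩⟩
    all_goals repeat' first
      | exact zero_mem _ | apply add_mem | apply sub_mem | apply neg_mem | apply Subalgebra.smul_mem
      | apply mul_mem | exact Algebra.subset_adjoin (by simp)
    all_goals simp only [add_mul, sub_mul, neg_mul, smul_mul_assoc, mul_assoc, zero_mul]
    all_goals module
  have top : adjoin k {x1, y, T, z, t, w, u, s, x2} = ⊤ :=
    top_le_iff.1 (hA.ge.trans (Algebra.adjoin_mono (by grind)))
  rw [insert_empty_eq, top, Algebra.top_toSubmodule, one_mul] at hx1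
  simp only [Submodule.span_mul_span] at hx1
  refine top_le_iff.1 (hx1.trans (Submodule.span_mono ?_))
  rintro _ ⟨_, ⟨_, ⟨_, ⟨_, ⟨_, ⟨_, ⟨_, ⟨_, ⟨m1, rfl⟩, _, ⟨m2, rfl⟩, rfl⟩, _, ⟨m3, rfl⟩, rfl⟩,
    _, ⟨m4, rfl⟩, rfl⟩, _, ⟨m5, rfl⟩, rfl⟩, _, ⟨m6, rfl⟩, rfl⟩, _, ⟨m7, rfl⟩, rfl⟩,
    _, ⟨m8, rfl⟩, rfl⟩, _, ⟨m9, rfl⟩, rfl⟩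
  exact ⟨⟨m1, m2, m3, m4, m5, m6, m7, m8, m9⟩, rfl⟩

end Spanning

section Grading

variable {k}

/-- A spanning family that has the same degrees as a basis is linearly independent, provided that
there are finitely many basis vectors in each degree. -/
lemma linearIndependent_of_graded {ι M : Type*} [AddCommGroup M] [Module k M]
    (b : Module.Basis ι k M) {deg : ι → ℕ} (hfin : ∀ n, {i | deg i ≤ n}.Finite) {v : ι → M}
    (hv : ∀ i j, b.repr (v i) j ≠ 0 → deg j = deg i)
    (hspan : Submodule.span k (Set.range v) = ⊤) : LinearIndependent k v := by
  classical
  let f : M →ₗ[k] M := b.constr k v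
  have hf : Function.Surjective f := by
    rw [← LinearMap.range_eq_top, ← hspan, Module.Basis.constr_range]
  let π (n : ℕ) : M →ₗ[k] M := b.constr k fun i => if deg i ≤ n then b i else 0
  have π_b n i : π n (b i) = if deg i ≤ n then b i else 0 := b.constr_basis ..
  have π_v n i : π n (v i) = if deg i ≤ n then v i else 0 := by
    rw [← b.linearCombination_repr (v i), Finsupp.linearCombination_apply, Finsupp.sum, map_sum]
    split_ifs with h
    · refine Finset.sum_congr rfl fun j hj => ?_
      rw [map_smul, π_b, if_pos ((hv i j (Finsupp.mem_support_iff.1 hj)).trans_le h)]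
    · refine Finset.sum_eq_zero fun j hj => ?_
      rw [map_smul, π_b, if_neg (by rwa [hv i j (Finsupp.mem_support_iff.1 hj)]), smul_zero]
  have comm n m : f (π n m) = π n (f m) := by
    have : f ∘ₗ π n = π n ∘ₗ f := b.ext fun i => by
      simp only [LinearMap.comp_apply, π_b, f, b.constr_basis, π_v]
      split_ifs <;> simp
    exact LinearMap.congr_fun this m
  have mem_range m : ∃ n, π n m = m := by
    refine ⟨(b.repr m).support.sup deg, ?_⟩
    have hm := b.linearCombination_repr m
    rw [Finsupp.linearCombination_apply, Finsupp.sum] at hm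
    refine (congrArg (π _) hm.symm).trans (.trans ?_ hm)
    rw [map_sum]
    refine Finset.sum_congr rfl fun j hj => ?_
    rw [map_smul, π_b, if_pos (Finset.le_sup hj)]
  have inj : Function.Injective f := by
    rw [injective_iff_map_eq_zero]
    intro m hm
    obtain ⟨n, hn⟩ := mem_range m
    let F := LinearMap.range (π n)
    have : FiniteDimensional k F := by
      have : F = Submodule.span k (b '' {i | deg i ≤ n}) := by
        refine le_antisymm ?_ (Submodule.span_le.2 ?_)
        · rw [show F = _ from b.constr_range .., Submodule.span_le, Set.range_subset_iff]
          intro i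
          split_ifs with hi
          · exact Submodule.subset_span ⟨i, hi, rfl⟩
          · exact zero_mem _
        · rintro _ ⟨i, hi, rfl⟩
          exact ⟨b i, by rw [π_b, if_pos (by exact hi)]⟩
      rw [this]
      exact FiniteDimensional.span_of_finite k ((hfin n).image b)
    have maps : ∀ x ∈ F, f x ∈ F := by
      rintro _ ⟨x, rfl⟩
      exact ⟨f x, (comm n x).symm⟩
    have surj : Function.Surjective (f.restrict maps) := by
      rintro ⟨_, x, rfl⟩
      obtain ⟨x, rfl⟩ := hf x
      exact ⟨⟨π n x, x, rfl⟩, Subtype.ext (comm n x)⟩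
    have := LinearMap.injective_iff_surjective.2 surj
    exact congrArg Subtype.val (this (a₁ := ⟨m, m, hn⟩) (a₂ := 0) (by ext; simpa using hm))
  have := b.linearIndependent.map' f (LinearMap.ker_eq_bot.2 inj)
  rwa [show f ∘ b = v from funext (b.constr_basis k v)] at this

/-- The linear map `X` raises degrees by `n`, where `Θ` acts on vectors of degree `d` as
`r ^ d`. -/
def Homogeneous {V : Type*} [AddCommGroup V] [Module k V] (r : k) (Θ : V →ₗ[k] V) (n : ℕ)
    (X : V →ₗ[k] V) : Prop :=
  ∀ v, Θ (X v) = r ^ n • X (Θ v)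

namespace Homogeneous

variable {V : Type*} [AddCommGroup V] [Module k V] {r : k} {Θ X Y : Module.End k V} {m n : ℕ}

lemma one : Homogeneous r Θ 0 1 := fun v => by simp

lemma mul (hX : Homogeneous r Θ m X) (hY : Homogeneous r Θ n Y) :
    Homogeneous r Θ (m + n) (X * Y) := fun v => by
  simp only [Module.End.mul_apply, hX (Y v), hY v, map_smul, smul_smul, pow_add]

lemma pow (hX : Homogeneous r Θ m X) : ∀ n : ℕ, Homogeneous r Θ (m * n) (X ^ n)
  | 0 => by simpa using one
  | n + 1 => by simpa [pow_succ, mul_add] using (hX.pow n).mul hX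

lemma add (hX : Homogeneous r Θ n X) (hY : Homogeneous r Θ n Y) : Homogeneous r Θ n (X + Y) :=
  fun v => by simp [hX v, hY v]

lemma smul (c : k) (hX : Homogeneous r Θ n X) : Homogeneous r Θ n (c • X) :=
  fun v => by simp [hX v, smul_comm c]

lemma sub (hX : Homogeneous r Θ n X) (hY : Homogeneous r Θ n Y) : Homogeneous r Θ n (X - Y) :=
  fun v => by simp [hX v, hY v, smul_sub]

end Homogeneous

/-- There is a basis indexed by `ι` whose vectors are eigenvectors of `Θ` with eigenvalues
`r ^ deg i`. -/
def HasDegreeBasis {V : Type*} [AddCommGroup V] [Module k V] (r : k) (Θ : V →ₗ[k] V) {ι : Type*}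
    (deg : ι → ℕ) : Prop :=
  ∃ b : Module.Basis ι k V, ∀ i, Θ (b i) = r ^ deg i • b i

/-- The degree operator on `V ⊕ V` where the second summand is shifted by `d`. -/
def double {V : Type*} [AddCommGroup V] [Module k V] (r : k) (d : ℕ) (Θ : V →ₗ[k] V) :
    V × V →ₗ[k] V × V :=
  Θ.prodMap (r ^ d • Θ)

@[simp]
lemma double_apply {V : Type*} [AddCommGroup V] [Module k V] (r : k) (d : ℕ) (Θ : V →ₗ[k] V)
    (v : V × V) : double r d Θ v = (Θ v.1, r ^ d • Θ v.2) := rfl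

namespace HasDegreeBasis

variable {V : Type*} [AddCommGroup V] [Module k V] {r : k} {Θ : V →ₗ[k] V} {ι κ : Type*}
  {deg : ι → ℕ}

protected lemma double (h : HasDegreeBasis r Θ deg) (d : ℕ) :
    HasDegreeBasis r (double r d Θ) fun i : Fin 2 × ι => d * (i.1 : ℕ) + deg i.2 := by
  obtain ⟨b, hb⟩ := h
  let e : ι ⊕ ι ≃ Fin 2 × ι := (Equiv.boolProdEquivSum ι).symm.trans
    (Equiv.prodCongrLeft fun _ => finTwoEquiv.symm)
  refine ⟨(b.prod b).reindex e, fun i => ?_⟩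
  obtain ⟨i | i, rfl⟩ := e.surjective i
  · simp [e, hb, finTwoEquiv]
  · simp [e, hb, finTwoEquiv, smul_smul, pow_add]

lemma polynomial (h : HasDegreeBasis r Θ deg) :
    HasDegreeBasis r (JordanTower.coeffwise Θ ∘ₗ JordanTower.scale V (r ^ 2))
      fun i : (ℕ × ℕ) × ι => 2 * (i.1.1 + i.1.2) + deg i.2 := by
  obtain ⟨b, hb⟩ := h
  refine ⟨(Finsupp.basis fun _ : ℕ × ℕ => b).reindex (Equiv.sigmaEquivProd _ _), fun i => ?_⟩
  simp [hb, smul_smul, pow_add, pow_mul]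

lemma reindex (h : HasDegreeBasis r Θ deg) (e : κ ≃ ι) :
    HasDegreeBasis r Θ fun i => deg (e i) := by
  obtain ⟨b, hb⟩ := h
  exact ⟨b.reindex e.symm, fun i => by simp [hb]⟩

lemma linearIndependent [CharZero k] {Θ : V →ₗ[k] V} (h : HasDegreeBasis 2 Θ deg)
    (hfin : ∀ n, {i | deg i ≤ n}.Finite) {v : ι → V} (hv : ∀ i, Θ (v i) = (2 : k) ^ deg i • v i)
    (hspan : Submodule.span k (Set.range v) = ⊤) : LinearIndependent k v := by
  obtain ⟨b, hb⟩ := h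
  refine linearIndependent_of_graded b hfin (fun i j hij => ?_) hspan
  have key : Finsupp.lapply j ∘ₗ b.repr.toLinearMap ∘ₗ Θ =
      (2 : k) ^ deg j • Finsupp.lapply j ∘ₗ b.repr.toLinearMap := b.ext fun i => by
    by_cases h : i = j <;> simp [hb, h]
  have := LinearMap.congr_fun key (v i)
  simp only [LinearMap.comp_apply, hv, map_smul, LinearMap.smul_apply, smul_eq_mul,
    Finsupp.lapply_apply, LinearEquiv.coe_coe] at this
  have := mul_right_cancel₀ hij this
  exact (Nat.pow_right_injective le_rfl (by exact_mod_cast this)).symm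

end HasDegreeBasis
end Grading

section CyclicModule

variable {k} {q} {V : Type*} [AddCommGroup V] [Module k V]

namespace SuperJordan

variable (k) in
/-- The degree operator on polynomials in `s` and `u`. -/
def weight (r : k) : (ℕ × ℕ →₀ k) →ₗ[k] (ℕ × ℕ →₀ k) :=
  Finsupp.lsum k fun i => r ^ (2 * i.1 + i.2) • Finsupp.lsingle i

@[simp]
lemma weight_single (r : k) (i : ℕ × ℕ) (c : k) :
    weight k r (Finsupp.single i c) = Finsupp.single i (r ^ (2 * i.1 + i.2) * c) := by
  rw [weight, Finsupp.lsum_single]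
  simp

lemma weight_shiftS (r : k) (a : ℕ × ℕ →₀ k) :
    weight k r (shiftS k a) = r ^ 2 • shiftS k (weight k r a) := by
  induction a using Finsupp.induction_linear with
  | zero => simp
  | add f g hf hg => simp only [map_add, hf, hg, smul_add]
  | single i c => simp [-Finsupp.single_mul]; congr 1; ring

lemma weight_shiftU (r : k) (a : ℕ × ℕ →₀ k) :
    weight k r (shiftU k a) = r • shiftU k (weight k r a) := by
  induction a using Finsupp.induction_linear with
  | zero => simp
  | add f g hf hg => simp only [map_add, hf, hg, smul_add]
  | single i c => simp [-Finsupp.single_mul]; congr 1; ring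

lemma weight_euler (r : k) (a : ℕ × ℕ →₀ k) :
    weight k r (euler k a) = euler k (weight k r a) := by
  induction a using Finsupp.induction_linear with
  | zero => simp
  | add f g hf hg => simp only [map_add, hf, hg]
  | single i c => simp [-Finsupp.single_mul]; congr 1; ring

lemma hasDegreeBasis_weight (r : k) :
    HasDegreeBasis r (weight k r) fun i : ℕ × ℕ => 2 * i.1 + i.2 :=
  ⟨Finsupp.basisSingleOne, fun i => by simp⟩

lemma homogeneous_opX2 (r : k) : Homogeneous r (double r 1 (weight k r)) 1 (opX2 k) :=
  fun v => by simp [opX2]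

lemma homogeneous_opU (r : k) : Homogeneous r (double r 1 (weight k r)) 1 (opU k) :=
  fun v => by
    ext1
    · simp [opU, weight_shiftU, weight_shiftS]
      module
    · simp [opU, weight_euler, weight_shiftU, smul_smul]

variable (k) in
/-- The cyclic vector of the regular representation. -/
def unit : (ℕ × ℕ →₀ k) × (ℕ × ℕ →₀ k) := (Finsupp.single 0 1, 0)

lemma double_weight_unit (r : k) : double r 1 (weight k r) (unit k) = unit k := by
  simp [unit]

lemma eq_top_of_stable {S : Submodule k ((ℕ × ℕ →₀ k) × (ℕ × ℕ →₀ k))} (h1 : unit k ∈ S)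
    (hx2 : ∀ v ∈ S, opX2 k v ∈ S) (hu : ∀ v ∈ S, opU k v ∈ S) : S = ⊤ := by
  have h_single (c d : ℕ) : (Finsupp.single (c, d) 1, 0) ∈ S := by
    induction c with
    | zero =>
      induction d with
      | zero => exact h1
      | succ d ih => simpa [opU] using hu _ ih
    | succ c ih =>
      simpa [opU, opX2] using add_mem (hu _ (hx2 _ ih)) (hx2 _ (hu _ ih))
  have h_fst (a : ℕ × ℕ →₀ k) : (a, 0) ∈ S := by
    induction a using Finsupp.induction_linear with
    | zero => exact zero_mem S
    | add f g hf hg => simpa using add_mem hf hg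
    | single i c => simpa using S.smul_mem c (h_single i.1 i.2)
  refine Submodule.eq_top_iff'.2 fun v => ?_
  simpa [opX2] using add_mem (h_fst v.1) (hx2 _ (h_fst v.2))

end SuperJordan

namespace ExtJordan

/-- The degree operator on `(V ⊕ tV) ⊕ w(V ⊕ tV)`. -/
def weight (r : k) (Θ : V →ₗ[k] V) : (V × V) × (V × V) →ₗ[k] (V × V) × (V × V) :=
  double r 3 (double r 3 Θ)

variable {r : k} {Θ x2 u : V →ₗ[k] V}

lemma homogeneous_opX2 (h : Homogeneous r Θ 1 x2) :
    Homogeneous r (weight r Θ) 1 (opX2 q x2) := fun v => by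
  ext <;> simp [weight, opX2, h _] <;> module

lemma homogeneous_opU (hx2 : Homogeneous r Θ 1 x2) (hu : Homogeneous r Θ 1 u) :
    Homogeneous r (weight r Θ) 1 (opU q x2 u) := fun v => by
  ext <;> simp [weight, opU, hx2 _, hu _] <;> module

lemma homogeneous_opW : Homogeneous r (weight r Θ) 3 opW := fun v => by
  ext <;> simp [weight, opW]

lemma homogeneous_opT : Homogeneous r (weight r Θ) 3 opT := fun v => by
  ext <;> simp [weight, opT]

lemma eq_top_of_stable {e : V}
    (hV : ∀ S : Submodule k V, e ∈ S → (∀ v ∈ S, x2 v ∈ S) → (∀ v ∈ S, u v ∈ S) → S = ⊤)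
    {S : Submodule k ((V × V) × (V × V))} (he : ((e, 0), 0) ∈ S)
    (hx2 : ∀ v ∈ S, opX2 q x2 v ∈ S) (hu : ∀ v ∈ S, opU q x2 u v ∈ S)
    (hw : ∀ v ∈ S, opW (k := k) v ∈ S) (ht : ∀ v ∈ S, opT (k := k) v ∈ S) : S = ⊤ := by
  have top := hV (S.comap (LinearMap.inl k (V × V) (V × V) ∘ₗ LinearMap.inl k V V)) he
    (fun v hv => by simpa [opX2, Prod.mk_zero_zero] using hx2 _ hv)
    (fun v hv => by simpa [opU, Prod.mk_zero_zero] using hu _ hv)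
  have h1 (a : V) : ((a, 0), 0) ∈ S := Submodule.eq_top_iff'.1 top a
  refine Submodule.eq_top_iff'.2 fun v => ?_
  simpa [opT, opW, Prod.mk_zero_zero] using add_mem (add_mem (h1 v.1.1) (ht _ (h1 v.1.2)))
    (hw _ (add_mem (h1 v.2.1) (ht _ (h1 v.2.2))))

end ExtJordan

namespace JordanTower

/-- The degree operator on `V`-valued polynomials in `z` and `T`. -/
def weight (r : k) (Θ : V →ₗ[k] V) : (ℕ × ℕ →₀ V) →ₗ[k] (ℕ × ℕ →₀ V) :=
  coeffwise Θ ∘ₗ scale V (r ^ 2)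

variable {r : k} {Θ x2 u w t : V →ₗ[k] V}

lemma _root_.Stmt17.Homogeneous.coeffwise_apply {n : ℕ} {X : V →ₗ[k] V}
    (h : Homogeneous r Θ n X) (p : ℕ × ℕ →₀ V) :
    coeffwise Θ (coeffwise X p) = r ^ n • coeffwise X (coeffwise Θ p) := by
  ext i
  simp [h _]

lemma scale_scale (a b : k) (p : ℕ × ℕ →₀ V) : scale V a (scale V b p) = scale V b (scale V a p) :=
  commute_of_single (f := scale V a ∘ₗ scale V b) (g := scale V b ∘ₗ scale V a)
    (fun i v => by simp [smul_smul, mul_comm]) p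

lemma homogeneous_mulZ : Homogeneous r (weight r Θ) 2 (mulZ k V) := fun v => by
  simp only [weight, LinearMap.comp_apply, scale_mulZ, map_smul, coeffwise_mulZ]

lemma homogeneous_opBigT (hr : r ≠ 0) : Homogeneous r (weight r Θ) 2 (opBigT k V) := fun v => by
  simp only [weight, opBigT, LinearMap.comp_apply, LinearMap.sub_apply, LinearMap.smul_apply,
    map_sub, map_smul, scale_mulZ, scale_mulT, scale_derivZ _ (pow_ne_zero 2 hr), coeffwise_mulZ,
    coeffwise_mulT, coeffwise_derivZ]
  match_scalars <;> field_simp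

lemma homogeneous_opX2 (hr : r ≠ 0) (hx2 : Homogeneous r Θ 1 x2) (hw : Homogeneous r Θ 3 w) :
    Homogeneous r (weight r Θ) 1 (opX2 q x2 w) := fun v => by
  simp only [weight, opX2, LinearMap.comp_apply, LinearMap.sub_apply, map_sub, map_smul,
    scale_derivT _ (pow_ne_zero 2 hr), coeffwise_derivT, ← coeffwise_scale,
    hx2.coeffwise_apply, hw.coeffwise_apply]
  simp only [coeffwise_scale, scale_scale (r ^ 2)]
  match_scalars <;> field_simp

lemma homogeneous_opU (hr : r ≠ 0) (hu : Homogeneous r Θ 1 u) (hw : Homogeneous r Θ 3 w)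
    (ht : Homogeneous r Θ 3 t) : Homogeneous r (weight r Θ) 1 (opU q u w t) := fun v => by
  simp only [weight, opU, LinearMap.comp_apply, LinearMap.sub_apply, LinearMap.add_apply,
    LinearMap.smul_apply, map_sub, map_add, map_smul, scale_mulT, coeffwise_mulT,
    scale_derivZ _ (pow_ne_zero 2 hr), coeffwise_derivZ,
    scale_derivT _ (pow_ne_zero 2 hr), coeffwise_derivT, ← coeffwise_scale,
    hu.coeffwise_apply, hw.coeffwise_apply, ht.coeffwise_apply]
  simp only [coeffwise_scale, scale_scale (r ^ 2)]
  match_scalars <;> field_simp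

lemma eq_top_of_stable {e : V}
    (hV : ∀ S : Submodule k V, e ∈ S → (∀ v ∈ S, x2 v ∈ S) → (∀ v ∈ S, u v ∈ S) →
      (∀ v ∈ S, w v ∈ S) → (∀ v ∈ S, t v ∈ S) → S = ⊤)
    {S : Submodule k (ℕ × ℕ →₀ V)} (he : Finsupp.single 0 e ∈ S)
    (hx2 : ∀ v ∈ S, opX2 q x2 w v ∈ S) (hu : ∀ v ∈ S, opU q u w t v ∈ S)
    (hw : ∀ v ∈ S, opW q w v ∈ S) (ht : ∀ v ∈ S, opT q w t v ∈ S)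
    (hz : ∀ v ∈ S, mulZ k V v ∈ S) (hT : ∀ v ∈ S, opBigT k V v ∈ S) : S = ⊤ := by
  have top := hV (S.comap (Finsupp.lsingle 0)) he
    (fun v hv => by simpa [opX2] using hx2 _ hv) (fun v hv => by simpa [opU] using hu _ hv)
    (fun v hv => by simpa [opW] using hw _ hv) (fun v hv => by simpa [opT] using ht _ hv)
  have h_single (v : V) (a b : ℕ) : Finsupp.single (a, b) v ∈ S := by
    induction a with
    | zero =>
      induction b with
      | zero => exact Submodule.eq_top_iff'.1 top v
      | succ b ih => simpa [opBigT] using hT _ ih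
    | succ a ih => simpa using hz _ ih
  refine Submodule.eq_top_iff'.2 fun v => ?_
  induction v using Finsupp.induction_linear with
  | zero => exact zero_mem S
  | add f g hf hg => exact add_mem hf hg
  | single i v => exact h_single v i.1 i.2

/-- The degree operator on `(V ⊕ yV) ⊕ x1(V ⊕ yV)`. -/
def extWeight (r : k) (Θ : V →ₗ[k] V) : (V × V) × (V × V) →ₗ[k] (V × V) × (V × V) :=
  double r 1 (double r 1 Θ)

variable {z T : V →ₗ[k] V}

lemma homogeneous_extX1 : Homogeneous r (extWeight r Θ) 1 extX1 := fun v => by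
  ext <;> simp [extWeight, extX1]

lemma homogeneous_extY : Homogeneous r (extWeight r Θ) 1 extY := fun v => by
  ext <;> simp [extWeight, extY]

lemma homogeneous_extX2 (hx2 : Homogeneous r Θ 1 x2) (hz : Homogeneous r Θ 2 z) :
    Homogeneous r (extWeight r Θ) 1 (extX2 q x2 z) := fun v => by
  ext <;> simp [extWeight, extX2, hx2 _, hz _] <;> module

lemma homogeneous_extU (hx2 : Homogeneous r Θ 1 x2) (hu : Homogeneous r Θ 1 u)
    (hz : Homogeneous r Θ 2 z) (hT : Homogeneous r Θ 2 T) :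
    Homogeneous r (extWeight r Θ) 1 (extU q x2 u z T) := fun v => by
  ext <;> simp [extWeight, extU, hx2 _, hu _, hz _, hT _] <;> module

lemma eq_top_of_ext_stable {e : V}
    (hV : ∀ S : Submodule k V, e ∈ S → (∀ v ∈ S, x2 v ∈ S) → (∀ v ∈ S, u v ∈ S) →
      (∀ v ∈ S, w v ∈ S) → (∀ v ∈ S, t v ∈ S) → (∀ v ∈ S, z v ∈ S) → (∀ v ∈ S, T v ∈ S) → S = ⊤)
    {S : Submodule k ((V × V) × (V × V))} (he : ((e, 0), 0) ∈ S)
    (hx1 : ∀ v ∈ S, extX1 (k := k) v ∈ S) (hy : ∀ v ∈ S, extY (k := k) v ∈ S)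
    (hx2 : ∀ v ∈ S, extX2 q x2 z v ∈ S) (hu : ∀ v ∈ S, extU q x2 u z T v ∈ S)
    (hw : ∀ v ∈ S, extW q w z v ∈ S) (ht : ∀ v ∈ S, extT q w t z T v ∈ S)
    (hz : ∀ v ∈ S, extZ q z v ∈ S) (hT : ∀ v ∈ S, extBigT q z T v ∈ S) : S = ⊤ := by
  have top := hV (S.comap (LinearMap.inl k (V × V) (V × V) ∘ₗ LinearMap.inl k V V)) he
    (fun v hv => by simpa [extX2, Prod.mk_zero_zero] using hx2 _ hv)
    (fun v hv => by simpa [extU, Prod.mk_zero_zero] using hu _ hv)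
    (fun v hv => by simpa [extW, Prod.mk_zero_zero] using hw _ hv)
    (fun v hv => by simpa [extT, Prod.mk_zero_zero] using ht _ hv)
    (fun v hv => by simpa [extZ, Prod.mk_zero_zero] using hz _ hv)
    (fun v hv => by simpa [extBigT, Prod.mk_zero_zero] using hT _ hv)
  have h1 (a : V) : ((a, 0), 0) ∈ S := Submodule.eq_top_iff'.1 top a
  refine Submodule.eq_top_iff'.2 fun v => ?_
  simpa [extX1, extY, Prod.mk_zero_zero] using add_mem (add_mem (h1 v.1.1) (hy _ (h1 v.1.2)))
    (hx1 _ (add_mem (h1 v.2.1) (hy _ (h1 v.2.2))))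

end JordanTower

end CyclicModule

section Presentation

variable {k} {q} {A : Type*} [Ring A] [Algebra k A] {X1 Y X2 U Z BT S Tt W : A}

namespace NicholsRel

lemma lift_z (h : NicholsRel q X1 Y X2 U Z BT S Tt W) :
    FreeAlgebra.lift k ![X1, Y, X2, U] (z k q) = Z := by
  simp [z, y, x2, h.z_def]

lemma lift_T (h : NicholsRel q X1 Y X2 U Z BT S Tt W) :
    FreeAlgebra.lift k ![X1, Y, X2, U] (T k q) = BT := by
  simp [T, y, x2, u, h.T_def]

lemma lift_s (h : NicholsRel q X1 Y X2 U Z BT S Tt W) :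
    FreeAlgebra.lift k ![X1, Y, X2, U] (s k) = S := by
  simp [s, x2, u, h.s_def]

lemma lift_t (h : NicholsRel q X1 Y X2 U Z BT S Tt W) :
    FreeAlgebra.lift k ![X1, Y, X2, U] (t k q) = Tt := by
  simp [t, u, h.lift_T, h.t_def]

lemma lift_w (h : NicholsRel q X1 Y X2 U Z BT S Tt W) :
    FreeAlgebra.lift k ![X1, Y, X2, U] (w k q) = W := by
  simp [w, x2, h.lift_T, h.w_def]

lemma lift_eq_of_rel (h : NicholsRel q X1 Y X2 U Z BT S Tt W) (hq : q ≠ 0)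
    ⦃a b : FreeAlgebra k (Fin 4)⦄ (hab : rel k q a b) :
    FreeAlgebra.lift k ![X1, Y, X2, U] a = FreeAlgebra.lift k ![X1, Y, X2, U] b := by
  obtain ⟨ha, rfl⟩ := hab
  have e1 : FreeAlgebra.lift k ![X1, Y, X2, U] (x1 k) = X1 := by simp [x1]
  have e2 : FreeAlgebra.lift k ![X1, Y, X2, U] (y k) = Y := by simp [y]
  have e3 : FreeAlgebra.lift k ![X1, Y, X2, U] (x2 k) = X2 := by simp [x2]
  have e4 : FreeAlgebra.lift k ![X1, Y, X2, U] (u k) = U := by simp [u]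
  simp only [rels, Set.mem_insert_iff, Set.mem_singleton_iff] at ha
  rcases ha with rfl | rfl | rfl | rfl | rfl | rfl | rfl | rfl | rfl | rfl | rfl | rfl | rfl <;>
    simp only [map_add, map_sub, map_mul, map_smul, map_zero, sq, e1, e2, e3, e4,
      h.lift_z, h.lift_T, h.lift_s, h.lift_t, h.lift_w, h.x1_x1, h.y_y, h.x1_y, h.x1_x2, h.x2_x2,
      h.z_x2, h.x1_u, h.z_u, h.t_u, h.y_t, h.w_u, h.T_z, h.u_s, smul_neg, smul_smul,
      inv_mul_cancel₀ hq] <;>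
    module

/-- The representation of the Nichols algebra given by elements satisfying its relations. -/
def liftHom (h : NicholsRel q X1 Y X2 U Z BT S Tt W) (hq : q ≠ 0) :
    RingQuot (rel k q) →ₐ[k] A :=
  RingQuot.liftAlgHom k ⟨FreeAlgebra.lift k ![X1, Y, X2, U], h.lift_eq_of_rel hq⟩

lemma liftHom_mk (h : NicholsRel q X1 Y X2 U Z BT S Tt W) (hq : q ≠ 0)
    (a : FreeAlgebra k (Fin 4)) :
    h.liftHom hq (RingQuot.mkAlgHom k (rel k q) a) = FreeAlgebra.lift k ![X1, Y, X2, U] a :=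
  RingQuot.liftAlgHom_mkAlgHom_apply ..

lemma liftHom_mon (h : NicholsRel q X1 Y X2 U Z BT S Tt W) (hq : q ≠ 0) (i : Idx) :
    h.liftHom hq (mon k q i) = X2 ^ (i.m1 : ℕ) * S ^ i.m2 * U ^ i.m3 * W ^ (i.m4 : ℕ) *
      Tt ^ (i.m5 : ℕ) * Z ^ i.m6 * BT ^ i.m7 * Y ^ (i.m8 : ℕ) * X1 ^ (i.m9 : ℕ) := by
  rw [mon, h.liftHom_mk]
  simp only [map_mul, map_pow, h.lift_z, h.lift_T, h.lift_s, h.lift_t, h.lift_w]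
  simp [x1, y, x2, u]

end NicholsRel

lemma nicholsRel_mk (hq : q ≠ 0) (π : FreeAlgebra k (Fin 4) →ₐ[k] A)
    (hπ : ∀ a ∈ rels k q, π a = 0) :
    NicholsRel q (π (x1 k)) (π (y k)) (π (x2 k)) (π (u k)) (π (z k q)) (π (T k q)) (π (s k))
      (π (t k q)) (π (w k q)) := by
  simp only [rels, Set.forall_mem_insert, Set.mem_singleton_iff, forall_eq, map_add, map_sub,
    map_mul, map_smul, sq] at hπ
  obtain ⟨h1, h2, h3, h4, h5, h6, h7, h8, h9, h10, h11, h12, h13⟩ := hπ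
  constructor
  case z_def => simp [z]
  case T_def => simp [T]
  case s_def => simp [s]
  case t_def => simp [t]
  case w_def => simp [w]
  case x1_x1 => exact h1
  case y_y => exact h2
  case x1_y => exact eq_neg_of_add_eq_zero_left h3
  case x1_x2 => exact sub_eq_zero.1 h4
  case x2_x2 => exact h5
  case z_x2 =>
    have := congrArg (q • ·) h6
    simp only [smul_add, smul_smul, mul_inv_cancel₀ hq, one_smul, smul_zero] at this
    linear_combination (norm := module) this
  case x1_u => linear_combination (norm := module) h7
  case z_u => linear_combination (norm := module) h8
  case t_u => linear_combination (norm := module) h9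
  case y_t => linear_combination (norm := module) h10
  case w_u => linear_combination (norm := module) h11
  case T_z => linear_combination (norm := module) h12
  case u_s => linear_combination (norm := module) h13

variable (k q) in
lemma adjoin_generators :
    Algebra.adjoin k {RingQuot.mkAlgHom k (rel k q) (x1 k), RingQuot.mkAlgHom k (rel k q) (y k),
      RingQuot.mkAlgHom k (rel k q) (x2 k), RingQuot.mkAlgHom k (rel k q) (u k)} = ⊤ := by
  have h : Set.range (FreeAlgebra.ι k) = {x1 k, y k, x2 k, u k} := by
    ext a
    simp [Fin.exists_fin_succ, x1, y, x2, u, eq_comm]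
  have := congrArg (Subalgebra.map (RingQuot.mkAlgHom k (rel k q)))
    (FreeAlgebra.adjoin_range_ι k (Fin 4))
  rw [h, AlgHom.map_adjoin, Algebra.map_top,
    (AlgHom.range_eq_top _).2 (RingQuot.mkAlgHom_surjective k (rel k q))] at this
  simpa [Set.image_insert_eq] using this

lemma span_mon [CharZero k] (hq : q ≠ 0) : Submodule.span k (Set.range (mon k q)) = ⊤ := by
  have h := nicholsRel_mk hq (RingQuot.mkAlgHom k (rel k q)) fun a ha => by
    rw [RingQuot.mkAlgHom_rel k (show rel k q a 0 from ⟨ha, rfl⟩), map_zero]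
  have span := (h.rewriteRules.pbwRules hq).span_eq_top (adjoin_generators k q)
  simp only [← map_pow, ← map_mul] at span
  exact span

/-- The degree of a PBW monomial. -/
def Idx.degree (i : Idx) : ℕ :=
  i.m1 + 2 * i.m2 + i.m3 + 3 * i.m4 + 3 * i.m5 + 2 * i.m6 + 2 * i.m7 + i.m8 + i.m9

/-- The exponents of a PBW monomial, in the order in which the regular representation is built. -/
def Idx.equiv : Idx ≃ Fin 2 × Fin 2 × (ℕ × ℕ) × Fin 2 × Fin 2 × Fin 2 × (ℕ × ℕ) where
  toFun i := (i.m9, i.m8, (i.m6, i.m7), i.m4, i.m5, i.m1, (i.m2, i.m3))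
  invFun p := ⟨p.2.2.2.2.2.1, p.2.2.2.2.2.2.1, p.2.2.2.2.2.2.2, p.2.2.2.1, p.2.2.2.2.1,
    p.2.2.1.1, p.2.2.1.2, p.2.1, p.1⟩
  left_inv _ := rfl
  right_inv _ := rfl

lemma Idx.finite_degree_le (n : ℕ) : {i : Idx | i.degree ≤ n}.Finite := by
  refine ((Set.finite_Iic ((1, 1, (n, n), 1, 1, 1, (n, n)) :
    Fin 2 × Fin 2 × (ℕ × ℕ) × Fin 2 × Fin 2 × Fin 2 × (ℕ × ℕ))).preimage
      Idx.equiv.injective.injOn).subset fun i hi => ?_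
  simp only [Set.mem_ofPred_eq, Idx.degree] at hi
  simp only [Set.mem_preimage, Set.mem_Iic, Idx.equiv, Equiv.coe_fn_mk, Prod.mk_le_mk]
  refine ⟨?_, ?_, ⟨?_, ?_⟩, ?_, ?_, ?_, ?_, ?_⟩ <;> first | exact Fin.le_last _ | lia

end Presentation

section Independence

variable {k} {q} {M : Type*} [AddCommGroup M] [Module k M]
  {X1 Y X2 U Z BT S Tt W Θ : Module.End k M}

lemma NicholsRel.linearIndependent_mon [CharZero k] (hq : q ≠ 0)
    (h : NicholsRel q X1 Y X2 U Z BT S Tt W) (hΘ : HasDegreeBasis 2 Θ Idx.degree)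
    (hX1 : Homogeneous 2 Θ 1 X1) (hY : Homogeneous 2 Θ 1 Y) (hX2 : Homogeneous 2 Θ 1 X2)
    (hU : Homogeneous 2 Θ 1 U) {e : M} (he : Θ e = e)
    (cyclic : ∀ N : Submodule k M, e ∈ N → (∀ v ∈ N, X1 v ∈ N) → (∀ v ∈ N, Y v ∈ N) →
      (∀ v ∈ N, X2 v ∈ N) → (∀ v ∈ N, U v ∈ N) → (∀ v ∈ N, W v ∈ N) → (∀ v ∈ N, Tt v ∈ N) →
      (∀ v ∈ N, Z v ∈ N) → (∀ v ∈ N, BT v ∈ N) → N = ⊤) :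
    LinearIndependent k (mon k q) := by
  have hZ : Homogeneous 2 Θ 2 Z := h.z_def ▸ (hY.mul hX2).sub ((hX2.mul hY).smul q)
  have hBT : Homogeneous 2 Θ 2 BT := h.T_def ▸ (hY.mul hU).sub (((hU.add hX2).mul hY).smul q)
  have hS : Homogeneous 2 Θ 2 S := h.s_def ▸ (hU.mul hX2).add (hX2.mul hU)
  have hTt : Homogeneous 2 Θ 3 Tt := h.t_def ▸ (hBT.mul hU).add ((hU.mul hBT).smul q)
  have hW : Homogeneous 2 Θ 3 W := h.w_def ▸ (hBT.mul hX2).add ((hX2.mul hBT).smul q)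
  let orbit : RingQuot (rel k q) →ₗ[k] M :=
    LinearMap.applyₗ e ∘ₗ (h.liftHom hq).toLinearMap
  have orbit_apply a : orbit a = h.liftHom hq a e := rfl
  have stable (a : FreeAlgebra k (Fin 4)) :
      ∀ v ∈ LinearMap.range orbit,
        FreeAlgebra.lift k ![X1, Y, X2, U] a v ∈ LinearMap.range orbit := by
    rintro _ ⟨b, rfl⟩
    exact ⟨RingQuot.mkAlgHom k (rel k q) a * b, by
      rw [orbit_apply, map_mul, h.liftHom_mk, Module.End.mul_apply, orbit_apply]⟩
  have surj : LinearMap.range orbit = ⊤ := by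
    refine cyclic _ ⟨1, by simp [orbit_apply]⟩ ?_ ?_ ?_ ?_ ?_ ?_ ?_ ?_
    · simpa [x1] using stable (x1 k)
    · simpa [y] using stable (y k)
    · simpa [x2] using stable (x2 k)
    · simpa [u] using stable (u k)
    · simpa only [h.lift_w] using stable (w k q)
    · simpa only [h.lift_t] using stable (t k q)
    · simpa only [h.lift_z] using stable (z k q)
    · simpa only [h.lift_T] using stable (T k q)
  refine LinearIndependent.of_comp orbit
    (hΘ.linearIndependent Idx.finite_degree_le (fun i => ?_) ?_)
  · have := ((((((((hX2.pow i.m1).mul (hS.pow i.m2)).mul (hU.pow i.m3)).mul (hW.pow i.m4)).mul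
      (hTt.pow i.m5)).mul (hZ.pow i.m6)).mul (hBT.pow i.m7)).mul (hY.pow i.m8)).mul
      (hX1.pow i.m9) e
    rw [he, ← h.liftHom_mon hq] at this
    rw [Function.comp_apply, orbit_apply, this, Idx.degree]
    simp only [one_mul]
  · rw [Set.range_comp, Submodule.span_image, span_mon hq, Submodule.map_top, surj]

end Independence

section Regular

variable {k} {q}

open JordanTower in
lemma linearIndependent_mon [CharZero k] (hq : q ≠ 0) : LinearIndependent k (mon k q) := by
  have hE := ExtJordan.extend hq (SuperJordan.regular (k := k))
  have hJ := JordanTower.extend hq hE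
  have r0 : (2 : k) ≠ 0 := two_ne_zero
  have x2E := ExtJordan.homogeneous_opX2 (q := q) (SuperJordan.homogeneous_opX2 (2 : k))
  have uE := ExtJordan.homogeneous_opU (q := q) (SuperJordan.homogeneous_opX2 (2 : k))
    (SuperJordan.homogeneous_opU (2 : k))
  have wE := ExtJordan.homogeneous_opW (r := 2) (Θ := double 2 1 (SuperJordan.weight k 2))
  have tE := ExtJordan.homogeneous_opT (r := 2) (Θ := double 2 1 (SuperJordan.weight k 2))
  have x2J := homogeneous_opX2 (q := q) r0 x2E wE
  have uJ := homogeneous_opU (q := q) r0 uE wE tE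
  have zJ := homogeneous_mulZ (r := 2)
    (Θ := ExtJordan.weight 2 (double 2 1 (SuperJordan.weight k 2)))
  have TJ := homogeneous_opBigT (Θ := ExtJordan.weight 2 (double 2 1 (SuperJordan.weight k 2))) r0
  have basis := ((((((SuperJordan.hasDegreeBasis_weight (2 : k)).double 1).double 3).double
    3).polynomial.double 1).double 1).reindex Idx.equiv
  refine (JordanTower.nicholsRel hq hJ).linearIndependent_mon hq
    (e := ((Finsupp.single 0 ((SuperJordan.unit k, 0), 0), 0), 0)) ?_
    homogeneous_extX1 homogeneous_extY
    (homogeneous_extX2 x2J zJ) (homogeneous_extU x2J uJ zJ TJ) ?_ ?_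
  · convert basis using 1
    · rfl
    funext i
    simp only [Idx.degree, Idx.equiv, Equiv.coe_fn_mk]
    ring
  · have := SuperJordan.double_weight_unit (2 : k)
    simp [JordanTower.extWeight, JordanTower.weight, ExtJordan.weight, Prod.mk_zero_zero, this]
  · intro N he hx1 hy hx2 hu hw ht hz hT
    exact eq_top_of_ext_stable (fun N he hx2 hu hw ht hz hT => eq_top_of_stable
      (fun N he hx2 hu hw ht => ExtJordan.eq_top_of_stable
        (fun N he hx2 hu => SuperJordan.eq_top_of_stable he hx2 hu) he hx2 hu hw ht)
      he hx2 hu hw ht hz hT) he hx1 hy hx2 hu hw ht hz hT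

end Regular

theorem statement17 [IsAlgClosed k] [CharZero k] (hq : q ≠ 0) :
    LinearIndependent k (mon k q) ∧
      Submodule.span k (Set.range (mon k q)) = ⊤ :=
  ⟨linearIndependent_mon hq, span_mon hq⟩

end Stmt17
end
end

section
/- Let A be any associative k-algebra containing elements x1,y,x2,u that satisfy all of the following relations: x1² = y² = 0, x1·y = −y·x1; x1·x2 = q·x2·x1; z² = 0, x2·z = q⁻¹·z·x2; x1·u − q·(u − (1/2)·x2)·x1 = −(1/2)·z; t·x2 = q·x2·t; t·u = q·(u + (1/2)·x2)·t; t² = 0, t·z = −z·t; u·x2 = x2·u − (1/2)·x2². Then the following identities also hold in A: x1·z = −q·z·x1; y·z = −q·z·y; z·u = q·(u + (1/2)·x2)·z; x1·t = −q·(t − (1/2)·z)·x1; y·t = −q·(t − (1/2)·z)·y. -/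
/- Statement 19: commutation relations from Step 5 of the proof of Theorem 6.4 (ghost 𝒢 = 1),
   valid in any algebra with the defining relations of 𝔅(𝔖_{1,+}(q,−1/2)). -/

theorem statement19 {k A : Type*} [Field k] [IsAlgClosed k] [CharZero k]
    [Ring A] [Algebra k A]
    (q : k) (hq : q ≠ 0) (x1 y x2 u z t : A)
    (hz : z = y * x2 - q • (x2 * y))
    (ht : t = y * u - q • ((u - (2 : k)⁻¹ • x2) * y))
    (r1 : x1 ^ 2 = 0) (r2 : y ^ 2 = 0) (r3 : x1 * y = -(y * x1))
    (r4 : x1 * x2 = q • (x2 * x1))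
    (r5 : z ^ 2 = 0) (r6 : x2 * z = q⁻¹ • (z * x2))
    (r7 : x1 * u - q • ((u - (2 : k)⁻¹ • x2) * x1) = -((2 : k)⁻¹ • z))
    (r8 : t * x2 = q • (x2 * t))
    (r9 : t * u = q • ((u + (2 : k)⁻¹ • x2) * t))
    (r10 : t ^ 2 = 0) (r11 : t * z = -(z * t))
    (r12 : u * x2 = x2 * u - (2 : k)⁻¹ • x2 ^ 2) :
    (x1 * z = -(q • (z * x1))) ∧
    (y * z = -(q • (z * y))) ∧
    (z * u = q • ((u + (2 : k)⁻¹ • x2) * z)) ∧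
    (x1 * t = -(q • ((t - (2 : k)⁻¹ • z) * x1))) ∧
    (y * t = -(q • ((t - (2 : k)⁻¹ • z) * y))) := by
  have zx2 : z * x2 = q • (x2 * z) := by rw [r6, smul_inv_smul₀ hq]
  have yz : y * z = -(q • (z * y)) := by
    linear_combination (norm :=
      (simp only [pow_two, mul_sub, sub_mul, smul_mul_assoc, mul_smul_comm, mul_assoc, mul_zero,
        zero_mul]; module))
      y * hz + q • (hz * y) + r2 * x2 - q ^ 2 • (x2 * r2)
  refine ⟨?_, yz, ?_, ?_, ?_⟩
  · linear_combination (norm :=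
      (simp only [pow_two, mul_sub, sub_mul, mul_neg, neg_mul, smul_mul_assoc, mul_smul_comm,
        mul_assoc]; module))
      x1 * hz + r3 * x2 - q • (r4 * y) - q ^ 2 • (x2 * r3) - y * r4 + q • (hz * x1)
  · linear_combination (norm :=
      (simp only [pow_two, add_mul, mul_sub, sub_mul, smul_mul_assoc, mul_smul_comm,
        mul_assoc]; module))
      hz * u - y * r12 - ht * x2 + r8 + q • (x2 * ht) - q • (u * hz) + q ^ 2 • (r12 * y)
        - (2 : k)⁻¹ • (hz * x2) + (2 : k)⁻¹ • zx2
  · linear_combination (norm :=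
      (simp only [pow_two, mul_sub, sub_mul, mul_neg, neg_mul, smul_mul_assoc, mul_smul_comm,
        mul_assoc]; module))
      x1 * ht + r3 * u - y * r7 - q • (r7 * y) + (q * (2 : k)⁻¹) • (r4 * y) + (2 : k)⁻¹ • yz
        - q ^ 2 • (u * r3) + q ^ 2 • (x2 * r3) + q • (ht * x1) - (q * (2 : k)⁻¹) • (hz * x1)
  · linear_combination (norm :=
      (simp only [pow_two, mul_sub, sub_mul, smul_mul_assoc, mul_smul_comm, mul_assoc, mul_zero,
        zero_mul]; module))
      y * ht + r2 * u + q • (ht * y) - (q * (2 : k)⁻¹) • (hz * y) - q ^ 2 • (u * r2)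
        + q ^ 2 • (x2 * r2)
end
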